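/- arXiv:1510.07190 — 2 statements merged into one kernel-verified Lean document; each statement's English description precedes it below -/
import Mathlib

section
/- Let j ≥ 3 and let τ ∈ S_j be minimal overlapping. Then the following identity of formal power series in t with coefficients in the field ℚ(p,q,x) of rational functions holds: Σ_{n≥0} (t^n/[n]_{p,q}!) · (Σ_{σ∈S_n} x^{τ-mch(σ)} p^{coinv(σ)} q^{inv(σ)}) = 1/(1 − (t + Σ_{n≥1} (t^{n(j−1)+1}/[n(j−1)+1]_{p,q}!) · (x−1)^n · mp_{τ,n(j−1)+1}(p,q))). -/
open scoped Classical

noncomputable section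

namespace CWilf

/-- The number of descents of a permutation of `{0, …, n-1}` (0-based). -/
def des {n : ℕ} (σ : Equiv.Perm (Fin n)) : ℕ :=
  (Finset.univ.filter fun i : Fin n =>
    ∃ h : (i : ℕ) + 1 < n, σ ⟨(i : ℕ) + 1, h⟩ < σ i).card

/-- The number of inversions of `σ`. -/
def inv {n : ℕ} (σ : Equiv.Perm (Fin n)) : ℕ :=
  (Finset.univ.filter fun q : Fin n × Fin n => q.1 < q.2 ∧ σ q.2 < σ q.1).card

/-- The number of coinversions of `σ`. -/
def coinv {n : ℕ} (σ : Equiv.Perm (Fin n)) : ℕ :=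
  (Finset.univ.filter fun q : Fin n × Fin n => q.1 < q.2 ∧ σ q.1 < σ q.2).card

/-- The number of left-to-right minima of `σ`. -/
def LRmin {n : ℕ} (σ : Equiv.Perm (Fin n)) : ℕ :=
  (Finset.univ.filter fun j : Fin n => ∀ i : Fin n, i < j → σ j < σ i).card

/-- There is a `τ`-match of `σ` starting at (0-based) position `i`, i.e.
`red(σ_i σ_{i+1} ⋯ σ_{i+j-1}) = τ`. -/
def MatchAt {j n : ℕ} (τ : Equiv.Perm (Fin j)) (σ : Equiv.Perm (Fin n)) (i : ℕ) : Prop :=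
  ∃ h : i + j ≤ n, ∀ a b : Fin j,
    τ a < τ b ↔
      σ ⟨i + (a : ℕ), by have := a.isLt; omega⟩ < σ ⟨i + (b : ℕ), by have := b.isLt; omega⟩

/-- The number of `τ`-matches of `σ`. -/
def mch {j n : ℕ} (τ : Equiv.Perm (Fin j)) (σ : Equiv.Perm (Fin n)) : ℕ :=
  ((Finset.range n).filter fun i => MatchAt τ σ i).card

/-- `τ` is minimal overlapping: the smallest `n` such that some `σ ∈ S_n` has
exactly two `τ`-matches is `2j - 1`. -/
def MinOverlapping {j : ℕ} (τ : Equiv.Perm (Fin j)) : Prop :=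
  IsLeast {n : ℕ | ∃ σ : Equiv.Perm (Fin n), mch τ σ = 2} (2 * j - 1)

/-- `α` and `β` are mutually minimal overlapping. -/
def MutuallyMinOverlapping {j : ℕ} (α β : Equiv.Perm (Fin j)) : Prop :=
  MinOverlapping α ∧ MinOverlapping β ∧
    IsLeast {n : ℕ | ∃ σ : Equiv.Perm (Fin n), 1 ≤ mch α σ ∧ 1 ≤ mch β σ} (2 * j - 1)

/-- The set of permutations of `S_n` with no `τ`-match. -/
def NM (n : ℕ) {j : ℕ} (τ : Equiv.Perm (Fin j)) : Finset (Equiv.Perm (Fin n)) :=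
  Finset.univ.filter fun σ => mch τ σ = 0

/-- The `p,q`-analogue `[n]_{p,q} = p^{n-1} + p^{n-2}q + ⋯ + q^{n-1}`. -/
def pqInt {K : Type} [CommSemiring K] (p q : K) (n : ℕ) : K :=
  ∑ i ∈ Finset.range n, p ^ (n - 1 - i) * q ^ i

/-- The `p,q`-factorial `[n]_{p,q}!`. -/
def pqFact {K : Type} [CommSemiring K] (p q : K) : ℕ → K
  | 0 => 1
  | n + 1 => pqFact p q n * pqInt p q (n + 1)

/-- The `p,q`-binomial coefficient, taken to be `0` when `k > n`. -/
def pqBinom {K : Type} [Field K] (p q : K) (n k : ℕ) : K :=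
  if k ≤ n then pqFact p q n / (pqFact p q k * pqFact p q (n - k)) else 0

/-- The `q`-analogue `[n]_q = 1 + q + ⋯ + q^{n-1}`. -/
def qInt {K : Type} [CommSemiring K] (q : K) (n : ℕ) : K :=
  ∑ i ∈ Finset.range n, q ^ i

/-- The `q`-factorial `[n]_q!`. -/
def qFact {K : Type} [CommSemiring K] (q : K) : ℕ → K
  | 0 => 1
  | n + 1 => qFact q n * qInt q (n + 1)

/-- The `q`-binomial coefficient, taken to be `0` when `k > n`. -/
def qBinom {K : Type} [Field K] (q : K) (n k : ℕ) : K :=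
  if k ≤ n then qFact q n / (qFact q k * qFact q (n - k)) else 0

/-- `mp_{τ, n(j-1)+1}(p,q)`, the generating polynomial
`Σ_{σ ∈ MP_{τ,n(j-1)+1}} q^{inv σ} p^{coinv σ}` over maximum packings for `τ`. -/
def mpSum {j : ℕ} (τ : Equiv.Perm (Fin j)) (n : ℕ) {K : Type} [CommSemiring K] (p q : K) : K :=
  ∑ σ ∈ Finset.univ.filter (fun σ : Equiv.Perm (Fin (n * (j - 1) + 1)) => mch τ σ = n),
    q ^ inv σ * p ^ coinv σ

/-- The field `ℚ(p,q,x)` of rational functions in three variables. -/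
abbrev K3 : Type := FractionRing (MvPolynomial (Fin 3) ℚ)

/-- The variable `p` in `ℚ(p,q,x)`. -/
def pV : K3 := algebraMap (MvPolynomial (Fin 3) ℚ) K3 (MvPolynomial.X 0)
/-- The variable `q` in `ℚ(p,q,x)`. -/
def qV : K3 := algebraMap (MvPolynomial (Fin 3) ℚ) K3 (MvPolynomial.X 1)
/-- The variable `x` in `ℚ(p,q,x)`. -/
def xV : K3 := algebraMap (MvPolynomial (Fin 3) ℚ) K3 (MvPolynomial.X 2)

/-- The weight `p ^ coinv σ * q ^ inv σ` as a product over pairs of positions. -/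
lemma pow_coinv_mul_pow_inv {K : Type} [CommSemiring K] (p q : K) {n : ℕ}
    (σ : Equiv.Perm (Fin n)) :
    p ^ coinv σ * q ^ inv σ =
      ∏ a, ∏ b, if a < b then (if σ a < σ b then p else q) else 1 := by
  rw [coinv, inv, ← Finset.prod_const, ← Finset.prod_const, Finset.prod_filter,
    Finset.prod_filter, ← Finset.prod_mul_distrib, ← Finset.univ_product_univ,
    Finset.prod_product]
  refine Finset.prod_congr rfl fun a _ => Finset.prod_congr rfl fun b _ => ?_
  dsimp only
  by_cases hab : a < b
  · rcases lt_or_gt_of_ne (σ.injective.ne hab.ne) with h | h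
    · simp [hab, h, h.not_gt]
    · simp [hab, h, h.not_gt]
  · simp [hab]

/-- Every window of a permutation has a reduction. -/
lemma exists_matchAt {n m i : ℕ} (σ : Equiv.Perm (Fin n)) (h : i + m ≤ n) :
    ∃ α : Equiv.Perm (Fin m), MatchAt α σ i := by
  let f : Fin m → Fin n := fun a => σ ⟨i + a, by omega⟩
  have hf : Function.Injective f := fun a b hab => by
    have := σ.injective hab
    simp only [Fin.mk.injEq] at this
    exact Fin.ext (by omega)
  have hs : StrictMono (f ∘ Tuple.sort f) :=
    (Tuple.monotone_sort f).strictMono_of_injective (hf.comp (Tuple.sort f).injective)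
  refine ⟨(Tuple.sort f)⁻¹, h, fun a b => ?_⟩
  rw [← hs.lt_iff_lt]
  simp [f]

/-- Matches inside a window are matches of the reduction of that window. -/
lemma matchAt_window {j m n i : ℕ} {τ : Equiv.Perm (Fin j)} {α : Equiv.Perm (Fin m)}
    {σ : Equiv.Perm (Fin n)} (h : MatchAt α σ i) (k : ℕ) :
    MatchAt τ α k ↔ k + j ≤ m ∧ MatchAt τ σ (i + k) := by
  obtain ⟨hi, hα⟩ := h
  constructor
  · rintro ⟨hk, hτ⟩
    refine ⟨hk, by omega, fun a b => ?_⟩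
    rw [hτ, hα]
    simp only [add_assoc]
  · rintro ⟨hk, _, hτ⟩
    refine ⟨hk, fun a b => ?_⟩
    rw [hτ, hα]
    simp only [add_assoc]

lemma matchAt_unique {m n i : ℕ} {α β : Equiv.Perm (Fin m)} {σ : Equiv.Perm (Fin n)}
    (hα : MatchAt α σ i) (hβ : MatchAt β σ i) : α = β := by
  obtain ⟨_, hα⟩ := hα
  obtain ⟨_, hβ⟩ := hβ
  have hs : StrictMono (β ∘ α.symm) := fun a b hab => by
    rw [Function.comp_apply, Function.comp_apply, hβ, ← hα]
    simpa using hab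
  ext a
  have := congrArg (fun e : Fin m ≃o Fin m => e (α a))
    (Subsingleton.elim (hs.orderIsoOfSurjective _ (β.surjective.comp α.symm.surjective))
      (OrderIso.refl _))
  simpa using congrArg Fin.val this.symm

/-- The permutation whose first `m` values form the set `s` in the relative order `α`, and whose
remaining values are in the relative order `β`. -/
def glue {m l : ℕ} (s : {s : Finset (Fin (m + l)) // s.card = m}) (α : Equiv.Perm (Fin m))
    (β : Equiv.Perm (Fin l)) : Equiv.Perm (Fin (m + l)) :=
  finSumFinEquiv.symm.trans ((Equiv.sumCongr α β).trans
    (finSumEquivOfFinset s.2 (by rw [Finset.card_compl, s.2, Fintype.card_fin]; omega)))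

section Glue

variable {m l : ℕ} (s : {s : Finset (Fin (m + l)) // s.card = m}) (α : Equiv.Perm (Fin m))
  (β : Equiv.Perm (Fin l))

lemma glue_castAdd (a : Fin m) :
    glue s α β (Fin.castAdd l a) = s.1.orderEmbOfFin s.2 (α a) := by
  simp [glue]

lemma glue_natAdd (b : Fin l) :
    glue s α β (Fin.natAdd m b) = s.1ᶜ.orderEmbOfFin
      (by rw [Finset.card_compl, s.2, Fintype.card_fin]; omega) (β b) := by
  simp [glue]

lemma matchAt_glue_zero : MatchAt α (glue s α β) 0 := by
  refine ⟨by omega, fun a b => ?_⟩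
  have h (c : Fin m) (hc : 0 + (c : ℕ) < m + l) : (⟨0 + c, hc⟩ : Fin (m + l)) = Fin.castAdd l c :=
    Fin.ext (Nat.zero_add _)
  simp only [h, glue_castAdd, OrderEmbedding.lt_iff_lt]

lemma matchAt_glue : MatchAt β (glue s α β) m := by
  refine ⟨by omega, fun a b => ?_⟩
  have h (c : Fin l) (hc : m + (c : ℕ) < m + l) : (⟨m + c, hc⟩ : Fin (m + l)) = Fin.natAdd m c :=
    rfl
  simp only [h, glue_natAdd, OrderEmbedding.lt_iff_lt]

lemma glue_castAdd_injective : Function.Injective fun a => glue s α β (Fin.castAdd l a) :=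
  (glue s α β).injective.comp (Fin.castAdd_injective m l)

lemma glue_natAdd_injective : Function.Injective fun b => glue s α β (Fin.natAdd m b) :=
  (glue s α β).injective.comp (Fin.natAdd_injective l m)

lemma image_glue : Finset.univ.image (fun a => glue s α β (Fin.castAdd l a)) = s.1 := by
  refine Finset.eq_of_subset_of_card_le (fun x hx => ?_) ?_
  · obtain ⟨a, -, rfl⟩ := Finset.mem_image.1 hx
    rw [glue_castAdd]
    exact Finset.orderEmbOfFin_mem _ _ _
  · rw [Finset.card_image_of_injective _ (glue_castAdd_injective s α β), s.2]
    simp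

lemma image_glue_compl :
    Finset.univ.image (fun b => glue s α β (Fin.natAdd m b)) = s.1ᶜ := by
  refine Finset.eq_of_subset_of_card_le (fun x hx => ?_) ?_
  · obtain ⟨a, -, rfl⟩ := Finset.mem_image.1 hx
    rw [glue_natAdd]
    exact Finset.orderEmbOfFin_mem _ _ _
  · rw [Finset.card_image_of_injective _ (glue_natAdd_injective s α β), Finset.card_compl, s.2]
    simp

end Glue

lemma glue_bijective (m l : ℕ) : Function.Bijective
    fun z : {s : Finset (Fin (m + l)) // s.card = m} × Equiv.Perm (Fin m) × Equiv.Perm (Fin l) =>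
      glue z.1 z.2.1 z.2.2 := by
  rw [Fintype.bijective_iff_injective_and_card]
  constructor
  · rintro ⟨s, α, β⟩ ⟨s', α', β'⟩ h
    dsimp only at h
    have hs : s = s' := by
      apply Subtype.ext
      rw [← image_glue s α β, h, image_glue]
    have hα : α = α' :=
      matchAt_unique (matchAt_glue_zero s α β) (h ▸ matchAt_glue_zero s' α' β')
    have hβ : β = β' := matchAt_unique (matchAt_glue s α β) (h ▸ matchAt_glue s' α' β')
    rw [hs, hα, hβ]
  · rw [Fintype.card_prod, Fintype.card_prod, Fintype.card_finset_len, Fintype.card_perm,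
      Fintype.card_perm, Fintype.card_perm]
    simp only [Fintype.card_fin]
    rw [← mul_assoc, Nat.choose_symm_add, Nat.add_choose_mul_factorial_mul_factorial]

section Weights

variable {K : Type} [CommSemiring K] (p q : K)

/-- The generating polynomial of the relative positions of two blocks of sizes `m` and `l`. -/
def shuffleSum (m l : ℕ) : K :=
  ∑ s : {s : Finset (Fin (m + l)) // s.card = m},
    ∏ u ∈ s.1, ∏ v ∈ s.1ᶜ, if u < v then p else q

lemma weight_glue {m l : ℕ} (s : {s : Finset (Fin (m + l)) // s.card = m})
    (α : Equiv.Perm (Fin m)) (β : Equiv.Perm (Fin l)) :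
    p ^ coinv (glue s α β) * q ^ inv (glue s α β) =
      (∏ u ∈ s.1, ∏ v ∈ s.1ᶜ, if u < v then p else q) *
        ((p ^ coinv α * q ^ inv α) * (p ^ coinv β * q ^ inv β)) := by
  simp only [pow_coinv_mul_pow_inv]
  have hcross : (∏ u ∈ s.1, ∏ v ∈ s.1ᶜ, if u < v then p else q) =
      ∏ a, ∏ b, if glue s α β (Fin.castAdd l a) < glue s α β (Fin.natAdd m b) then p else q := by
    rw [← image_glue_compl s α β]
    conv_lhs => rw [← image_glue s α β]
    rw [Finset.prod_image (glue_castAdd_injective s α β).injOn]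
    refine Finset.prod_congr rfl fun a _ => ?_
    rw [Finset.prod_image (glue_natAdd_injective s α β).injOn]
  rw [hcross]
  have hlt (a : Fin m) (b : Fin l) : Fin.castAdd l a < Fin.natAdd m b := by
    rw [Fin.lt_def, Fin.val_castAdd, Fin.val_natAdd]; omega
  have hcast (a b : Fin m) : Fin.castAdd l a < Fin.castAdd l b ↔ a < b := Iff.rfl
  simp only [Fin.prod_univ_add, Finset.prod_mul_distrib, hlt, hcast, (hlt _ _).not_gt, if_true, if_false,
    Finset.prod_const_one, Fin.natAdd_lt_natAdd_iff]
  simp only [glue_castAdd, glue_natAdd, OrderEmbedding.lt_iff_lt]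
  ring

/-- A weighted sum of a function of the reductions of the first `m` and last `l` entries. -/
lemma sum_eq_shuffleSum_mul {m l n : ℕ} (hn : m + l = n) (φ : Equiv.Perm (Fin n) → K)
    (f : Equiv.Perm (Fin m) → K) (g : Equiv.Perm (Fin l) → K)
    (hφ : ∀ σ α β, MatchAt α σ 0 → MatchAt β σ m → φ σ = f α * g β) :
    ∑ σ, φ σ * (p ^ coinv σ * q ^ inv σ) =
      shuffleSum p q m l * ((∑ α, f α * (p ^ coinv α * q ^ inv α)) *
        ∑ β, g β * (p ^ coinv β * q ^ inv β)) := by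
  subst hn
  rw [← (glue_bijective m l).sum_comp, Fintype.sum_prod_type, shuffleSum, Finset.sum_mul]
  refine Finset.sum_congr rfl fun s _ => ?_
  rw [Fintype.sum_prod_type, Finset.sum_mul_sum, Finset.mul_sum]
  refine Finset.sum_congr rfl fun α _ => ?_
  rw [Finset.mul_sum]
  refine Finset.sum_congr rfl fun β _ => ?_
  dsimp only
  rw [weight_glue, hφ _ α β (matchAt_glue_zero s α β) (matchAt_glue s α β)]
  ring

lemma prod_compl_singleton {n : ℕ} (u : Fin (n + 1)) :
    (∏ v ∈ ({u} : Finset (Fin (n + 1)))ᶜ, if u < v then p else q) =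
      p ^ (n - u) * q ^ (u : ℕ) := by
  rw [Finset.prod_ite, Finset.prod_const, Finset.prod_const]
  have h1 : (({u} : Finset (Fin (n + 1)))ᶜ.filter fun v => u < v) = Finset.Ioi u := by
    ext v; simp only [Finset.mem_filter, Finset.mem_compl, Finset.mem_singleton, Finset.mem_Ioi]
    exact ⟨fun h => h.2, fun h => ⟨h.ne', h⟩⟩
  have h2 : (({u} : Finset (Fin (n + 1)))ᶜ.filter fun v => ¬ u < v) = Finset.Iio u := by
    ext v; simp only [Finset.mem_filter, Finset.mem_compl, Finset.mem_singleton, Finset.mem_Iio,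
      not_lt]
    exact ⟨fun h => lt_of_le_of_ne h.2 h.1, fun h => ⟨h.ne, h.le⟩⟩
  rw [h1, h2, Fin.card_Ioi, Fin.card_Iio]
  congr 2

lemma shuffleSum_one (l : ℕ) : shuffleSum p q 1 l = pqInt p q (l + 1) := by
  rw [shuffleSum, pqInt, add_comm l 1, ← Fin.sum_univ_eq_sum_range
    (fun i => p ^ (1 + l - 1 - i) * q ^ i)]
  symm
  refine Fintype.sum_bijective (fun u => ⟨{u}, Finset.card_singleton u⟩) ⟨?_, ?_⟩ _ _ ?_
  · intro u v h
    simpa using h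
  · rintro ⟨s, hs⟩
    obtain ⟨u, rfl⟩ := Finset.card_eq_one.1 hs
    exact ⟨u, rfl⟩
  · intro u
    rw [Finset.prod_singleton]
    obtain ⟨k, hk⟩ : ∃ k, k = 1 + l := ⟨_, rfl⟩
    obtain rfl : k = l + 1 := by omega
    revert u
    rw [← hk]
    intro u
    rw [prod_compl_singleton]
    rfl

lemma sum_weight_of_subsingleton {n : ℕ} (hn : n ≤ 1) (f : Equiv.Perm (Fin n) → K) :
    ∑ σ, f σ * (p ^ coinv σ * q ^ inv σ) = f 1 := by
  have : Subsingleton (Fin n) := Fin.subsingleton_iff_le_one.2 hn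
  rw [Fintype.sum_subsingleton _ (1 : Equiv.Perm (Fin n)), pow_coinv_mul_pow_inv]
  have h (a b : Fin n) : ¬ a < b := by rw [Subsingleton.elim a b]; exact lt_irrefl b
  simp [h]

/-- The joint distribution of `coinv` and `inv` on `S_n`. -/
lemma sum_weight_eq_pqFact (n : ℕ) :
    ∑ σ : Equiv.Perm (Fin n), p ^ coinv σ * q ^ inv σ = pqFact p q n := by
  induction n with
  | zero => simpa [pqFact] using sum_weight_of_subsingleton p q zero_le_one fun _ => 1
  | succ n ih =>
    have h := sum_eq_shuffleSum_mul p q (add_comm 1 n) (fun _ => 1) (fun _ => 1) (fun _ => 1)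
      (fun _ _ _ _ _ => (one_mul 1).symm)
    rw [sum_weight_of_subsingleton p q le_rfl] at h
    simp only [one_mul] at h
    rw [h, ih, shuffleSum_one, pqFact, mul_comm]

lemma shuffleSum_mul_pqFact (m l : ℕ) :
    shuffleSum p q m l * (pqFact p q m * pqFact p q l) = pqFact p q (m + l) := by
  have h := sum_eq_shuffleSum_mul p q (rfl : m + l = m + l) (fun _ => 1) (fun _ => 1) (fun _ => 1)
      (fun _ _ _ _ _ => (one_mul 1).symm)
  simpa only [one_mul, sum_weight_eq_pqFact, eq_comm] using h

end Weights

lemma pqFact_ne_zero (n : ℕ) : pqFact pV qV n ≠ 0 := by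
  induction n with
  | zero => exact one_ne_zero
  | succ n ih =>
    refine mul_ne_zero ih ?_
    have h : pqInt pV qV (n + 1) = algebraMap (MvPolynomial (Fin 3) ℚ) K3
        (pqInt (MvPolynomial.X 0) (MvPolynomial.X 1) (n + 1)) := by
      simp [pqInt, pV, qV]
    rw [h, Ne, FaithfulSMul.algebraMap_eq_zero_iff]
    intro h0
    have := congrArg (MvPolynomial.eval fun _ => (1 : ℚ)) h0
    simp only [pqInt, map_sum, map_mul, map_pow, MvPolynomial.eval_X, one_pow, mul_one,
      Finset.sum_const, Finset.card_range, map_zero, nsmul_eq_mul] at this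
    exact (Nat.cast_ne_zero.2 n.succ_ne_zero) this

section Matches

variable {j : ℕ} {τ : Equiv.Perm (Fin j)}

/-- Two distinct matches of a minimal overlapping pattern start at least `j - 1` apart. -/
lemma MinOverlapping.not_matchAt_add (hτ : MinOverlapping τ) {n i d : ℕ}
    {σ : Equiv.Perm (Fin n)} (hi : MatchAt τ σ i) (hd : 0 < d) (hdj : d < j - 1) :
    ¬ MatchAt τ σ (i + d) := by
  induction d using Nat.strong_induction_on with
  | _ d ih =>
  intro hid
  obtain ⟨α, hα⟩ := exists_matchAt (m := d + j) (i := i) σ (by have := hid.1; omega)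
  have hset : (Finset.range (d + j)).filter (fun k => MatchAt τ α k) = {0, d} := by
    ext k
    rw [Finset.mem_filter, matchAt_window hα, Finset.mem_range, Finset.mem_insert,
      Finset.mem_singleton]
    constructor
    · rintro ⟨-, hk, hm⟩
      by_contra! hne
      exact ih k (by omega) (by omega) (by omega) hm
    · rintro (rfl | rfl)
      · exact ⟨by omega, by omega, hi⟩
      · exact ⟨by omega, le_rfl, hid⟩
  have h2 : mch τ α = 2 := by rw [mch, hset, Finset.card_pair hd.ne]
  have := hτ.2 ⟨α, h2⟩
  omega

/-- A set of `k` integers in `[0, (k-1)g]` with gaps at least `g` is an arithmetic progression. -/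
lemma mul_mem_of_separated {g k : ℕ} {S : Finset ℕ} (hS : S.card = k)
    (hle : ∀ a ∈ S, a + g ≤ k * g) (hsep : ∀ a ∈ S, ∀ b ∈ S, a < b → a + g ≤ b) :
    ∀ i < k, i * g ∈ S := by
  induction k generalizing S with
  | zero => intro i hi; omega
  | succ k ih =>
    have hne : S.Nonempty := Finset.card_pos.1 (by omega)
    have hM := S.max'_mem hne
    set M := S.max' hne
    have hlt : ∀ a ∈ S.erase M, a + g ≤ M := fun a ha =>
      hsep a (Finset.mem_of_mem_erase ha) M hM
        (lt_of_le_of_ne (S.le_max' a (Finset.mem_of_mem_erase ha)) (Finset.ne_of_mem_erase ha))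
    have hMle : M ≤ k * g := by have := hle M hM; rw [Nat.succ_mul] at this; omega
    have hE := ih (S := S.erase M) (by rw [Finset.card_erase_of_mem hM]; omega)
      (fun a ha => (hlt a ha).trans hMle)
      (fun a ha b hb => hsep a (Finset.mem_of_mem_erase ha) b (Finset.mem_of_mem_erase hb))
    intro i hi
    rcases Nat.lt_succ_iff_lt_or_eq.1 hi with hi | rfl
    · exact Finset.mem_of_mem_erase (hE i hi)
    · have : i * g ≤ M := by
        rcases i with _ | i
        · simp
        · have := hlt _ (hE i (Nat.lt_succ_self i))
          rw [Nat.succ_mul]; exact this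
      rw [le_antisymm this hMle]
      exact hM

/-- The maximum packings are the permutations with matches at all multiples of `j - 1`. -/
lemma MinOverlapping.mch_eq_iff (hτ : MinOverlapping τ) (hj : 3 ≤ j) {k : ℕ}
    (σ : Equiv.Perm (Fin (k * (j - 1) + 1))) :
    mch τ σ = k ↔ ∀ i < k, MatchAt τ σ (i * (j - 1)) := by
  constructor
  · intro h i hi
    refine (Finset.mem_filter.1 (mul_mem_of_separated h (fun a ha => ?_)
      (fun a ha b hb hab => ?_) i hi)).2
    · have := (Finset.mem_filter.1 ha).2.1
      omega
    · by_contra! hlt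
      refine hτ.not_matchAt_add (Finset.mem_filter.1 ha).2 (d := b - a) (by omega) (by omega) ?_
      rw [Nat.add_sub_cancel' hab.le]
      exact (Finset.mem_filter.1 hb).2
  · intro h
    have hset : (Finset.range (k * (j - 1) + 1)).filter (fun i => MatchAt τ σ i) =
        (Finset.range k).image (fun i => i * (j - 1)) := by
      ext a
      simp only [Finset.mem_filter, Finset.mem_range, Finset.mem_image]
      constructor
      · rintro ⟨-, ha⟩
        have hdm := Nat.div_add_mod' a (j - 1)
        have hmod := Nat.mod_lt a (y := j - 1) (by omega)
        have hk : a / (j - 1) < k := by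
          rw [Nat.div_lt_iff_lt_mul (by omega)]
          have := ha.1
          omega
        refine ⟨a / (j - 1), hk, ?_⟩
        by_contra hne
        refine hτ.not_matchAt_add (h _ hk) (d := a % (j - 1)) (by omega) hmod ?_
        rwa [hdm]
      · rintro ⟨i, hi, rfl⟩
        refine ⟨?_, h i hi⟩
        have := (h i hi).1
        omega
    rw [mch, hset, Finset.card_image_of_injective _
      (fun a b hab => Nat.eq_of_mul_eq_mul_right (by omega) hab), Finset.card_range]

/-- The number of matches of `τ` in `σ` starting at position `i` or later. -/
def mchFrom (τ : Equiv.Perm (Fin j)) {n : ℕ} (σ : Equiv.Perm (Fin n)) (i : ℕ) : ℕ :=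
  ((Finset.Ico i n).filter fun k => MatchAt τ σ k).card

lemma mchFrom_zero {n : ℕ} (σ : Equiv.Perm (Fin n)) : mchFrom τ σ 0 = mch τ σ := by
  rw [mchFrom, mch, Finset.range_eq_Ico]

lemma mch_eq_mchFrom {m l n : ℕ} (hn : m + l = n) {σ : Equiv.Perm (Fin n)}
    {β : Equiv.Perm (Fin l)} (h : MatchAt β σ m) : mch τ β = mchFrom τ σ m := by
  subst hn
  rw [mch, mchFrom]
  refine Finset.card_bij (fun k _ => m + k) ?_ (fun _ _ _ _ => Nat.add_left_cancel) ?_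
  · intro k hk
    rw [Finset.mem_filter, matchAt_window h, Finset.mem_range] at hk
    rw [Finset.mem_filter, Finset.mem_Ico]
    exact ⟨by omega, hk.2.2⟩
  · intro k hk
    rw [Finset.mem_filter, Finset.mem_Ico] at hk
    have := hk.2.1
    refine ⟨k - m, ?_, by omega⟩
    rw [Finset.mem_filter, matchAt_window h, Finset.mem_range, Nat.add_sub_cancel' hk.1.1]
    exact ⟨by omega, by omega, hk.2⟩

lemma mchFrom_eq_succ {n i : ℕ} {σ : Equiv.Perm (Fin n)} (h : ¬ MatchAt τ σ i) :
    mchFrom τ σ i = mchFrom τ σ (i + 1) := by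
  rw [mchFrom, mchFrom]
  congr 1
  ext k
  simp only [Finset.mem_filter, Finset.mem_Ico]
  constructor
  · rintro ⟨hk, hm⟩
    have : k ≠ i := by rintro rfl; exact h hm
    exact ⟨by omega, hm⟩
  · rintro ⟨hk, hm⟩
    exact ⟨by omega, hm⟩

lemma mchFrom_of_matchAt (hj : 3 ≤ j) {n i : ℕ} {σ : Equiv.Perm (Fin n)} (h : MatchAt τ σ i) :
    mchFrom τ σ i = mchFrom τ σ (i + 1) + 1 := by
  have := h.1
  rw [mchFrom, mchFrom, ← Finset.insert_Ico_add_one_left_eq_Ico (by omega), Finset.filter_insert,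
    if_pos h, Finset.card_insert_of_notMem (by simp)]

lemma MinOverlapping.mchFrom_add (hτ : MinOverlapping τ) {n i d : ℕ} {σ : Equiv.Perm (Fin n)}
    (h : MatchAt τ σ i) (hd : d + 1 ≤ j - 1) :
    mchFrom τ σ (i + 1) = mchFrom τ σ (i + (d + 1)) := by
  induction d with
  | zero => rfl
  | succ d ih =>
    rw [ih (by omega)]
    exact mchFrom_eq_succ (hτ.not_matchAt_add h (by omega) (by omega))

variable {K : Type} [CommRing K] (x : K)

lemma MinOverlapping.pow_mchFrom (hτ : MinOverlapping τ) (hj : 3 ≤ j) {n : ℕ}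
    (σ : Equiv.Perm (Fin n)) (i : ℕ) :
    x ^ mchFrom τ σ i = x ^ mchFrom τ σ (i + 1) +
      if MatchAt τ σ i then (x - 1) * x ^ mchFrom τ σ (i + (j - 1)) else 0 := by
  split_ifs with h
  · have := hτ.mchFrom_add h (d := j - 2) (by omega)
    rw [show j - 2 + 1 = j - 1 by omega] at this
    rw [mchFrom_of_matchAt hj h, ← this]
    ring
  · rw [mchFrom_eq_succ h, add_zero]

lemma MinOverlapping.pow_mch_eq_add (hτ : MinOverlapping τ) (hj : 3 ≤ j) {n : ℕ}
    (σ : Equiv.Perm (Fin n)) (k : ℕ) :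
    x ^ mch τ σ = (∑ r ∈ Finset.range k, if ∀ i < r, MatchAt τ σ (i * (j - 1)) then
        (x - 1) ^ r * x ^ mchFrom τ σ (r * (j - 1) + 1) else 0) +
      if ∀ i < k, MatchAt τ σ (i * (j - 1)) then
        (x - 1) ^ k * x ^ mchFrom τ σ (k * (j - 1)) else 0 := by
  induction k with
  | zero => simp [mchFrom_zero]
  | succ k ih =>
    rw [ih, Finset.sum_range_succ, add_assoc]
    congr 1
    rw [hτ.pow_mchFrom x hj σ (k * (j - 1)), Nat.succ_mul]
    simp only [Nat.forall_lt_succ_right]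
    by_cases h : ∀ i < k, MatchAt τ σ (i * (j - 1)) <;>
      by_cases h' : MatchAt τ σ (k * (j - 1))
    · rw [if_pos h, if_pos h', if_pos h, if_pos ⟨h, h'⟩]
      ring
    · rw [if_pos h, if_neg h', if_pos h, if_neg (fun H => h' H.2)]
      ring
    · rw [if_neg h, if_neg h, if_neg (fun H => h H.1), add_zero]
    · rw [if_neg h, if_neg h, if_neg (fun H => h H.1), add_zero]

/-- The weight of `σ` as a chain of matches linked by single entries: `(x - 1) ^ k` if `σ` has
`k (j - 1) + 1` entries and matches at all multiples of `j - 1`, and `0` otherwise. -/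
def chainWeight (τ : Equiv.Perm (Fin j)) (m : ℕ) {n : ℕ} (σ : Equiv.Perm (Fin n)) : K :=
  if m = (m - 1) / (j - 1) * (j - 1) + 1 ∧
      ∀ i < (m - 1) / (j - 1), MatchAt τ σ (i * (j - 1)) then
    (x - 1) ^ ((m - 1) / (j - 1))
  else 0

lemma chainWeight_eq_of_matchAt (hj : 3 ≤ j) {m n : ℕ} {σ : Equiv.Perm (Fin n)}
    {α : Equiv.Perm (Fin m)} (h : MatchAt α σ 0) :
    chainWeight x τ m σ = chainWeight x τ m α := by
  rw [chainWeight, chainWeight]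
  refine if_congr (and_congr_right fun hm => forall₂_congr fun i hi => ?_) rfl rfl
  rw [matchAt_window h, zero_add, and_iff_right]
  have := Nat.mul_le_mul_right (j - 1) (Nat.succ_le_of_lt hi)
  rw [Nat.succ_mul] at this
  omega

/-- Expansion of `x ^ mch τ σ` over the initial chains of `σ`. -/
lemma MinOverlapping.pow_mch_eq_sum (hτ : MinOverlapping τ) (hj : 3 ≤ j) {n : ℕ} (hn : 0 < n)
    (σ : Equiv.Perm (Fin n)) :
    x ^ mch τ σ = ∑ z ∈ Finset.HasAntidiagonal.antidiagonal n,
      chainWeight x τ z.1 σ * x ^ mchFrom τ σ z.1 := by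
  have hD : ∀ k, (∀ i < k, MatchAt τ σ (i * (j - 1))) → k * (j - 1) + 1 ≤ n := by
    intro k hk
    rcases k with _ | k
    · simpa [Nat.succ_le_iff] using hn
    · have := (hk k (Nat.lt_succ_self k)).1
      rw [Nat.succ_mul]
      omega
  have hle (k : ℕ) : k ≤ k * (j - 1) := Nat.le_mul_of_pos_right k (by omega)
  have hdiv (k : ℕ) : (k * (j - 1) + 1 - 1) / (j - 1) = k := by
    rw [Nat.add_sub_cancel, Nat.mul_div_cancel _ (by omega)]
  rw [hτ.pow_mch_eq_add x hj σ n, if_neg (fun h => by have := hD n h; have := hle n; omega),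
    add_zero, Finset.Nat.sum_antidiagonal_eq_sum_range_succ_mk, ← Finset.sum_filter]
  refine Finset.sum_of_injOn (fun k => k * (j - 1) + 1) ?_ ?_ ?_ ?_
  · intro a _ b _ hab
    exact Nat.eq_of_mul_eq_mul_right (by omega) (Nat.succ_injective hab)
  · intro k hk
    have := hD k (Finset.mem_filter.1 hk).2
    simp only [Finset.coe_range, Set.mem_Iio]
    omega
  · intro m hm hnot
    rw [chainWeight, if_neg, zero_mul]
    rintro ⟨h1, h2⟩
    dsimp only at h1 h2
    refine hnot ⟨(m - 1) / (j - 1), ?_, h1.symm⟩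
    have := hle ((m - 1) / (j - 1))
    rw [Finset.mem_range] at hm
    simp only [Finset.coe_filter, Finset.mem_range, Set.mem_ofPred_eq]
    exact ⟨by omega, h2⟩
  · intro k hk
    dsimp only
    rw [chainWeight, hdiv, if_pos ⟨rfl, (Finset.mem_filter.1 hk).2⟩]

/-- The total weight of chains, in terms of maximum packings. -/
lemma MinOverlapping.sum_chainWeight (hτ : MinOverlapping τ) (hj : 3 ≤ j) (p q : K) (m : ℕ) :
    ∑ α : Equiv.Perm (Fin m), chainWeight x τ m α * (p ^ coinv α * q ^ inv α) =
      if m = 1 then 1 else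
        if 1 ≤ (m - 1) / (j - 1) ∧ m = (m - 1) / (j - 1) * (j - 1) + 1 then
          (x - 1) ^ ((m - 1) / (j - 1)) * mpSum τ ((m - 1) / (j - 1)) p q
        else 0 := by
  split_ifs with h1 h2
  · subst h1
    rw [sum_weight_of_subsingleton p q le_rfl]
    simp [chainWeight]
  · obtain ⟨-, h2⟩ := h2
    generalize hk : (m - 1) / (j - 1) = k at h2 ⊢
    subst h2
    rw [mpSum, Finset.sum_filter, Finset.mul_sum]
    refine Finset.sum_congr rfl fun α _ => ?_
    rw [chainWeight, hk]
    by_cases h : mch τ α = k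
    · rw [if_pos ⟨rfl, (hτ.mch_eq_iff hj α).1 h⟩, if_pos h, mul_comm (q ^ _)]
    · rw [if_neg (fun H => h ((hτ.mch_eq_iff hj α).2 H.2)), if_neg h, zero_mul, mul_zero]
  · refine Finset.sum_eq_zero fun α _ => ?_
    rw [chainWeight, if_neg, zero_mul]
    rintro ⟨h, -⟩
    refine h2 ⟨?_, h⟩
    by_contra h0
    rw [Nat.lt_one_iff.1 (not_le.1 h0)] at h
    exact h1 (by simpa using h)

/-- The recursion obtained by splitting off the initial chain. -/
lemma MinOverlapping.sum_pow_mch (hτ : MinOverlapping τ) (hj : 3 ≤ j) (p q : K) {n : ℕ}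
    (hn : 0 < n) :
    ∑ σ : Equiv.Perm (Fin n), x ^ mch τ σ * (p ^ coinv σ * q ^ inv σ) =
      ∑ z ∈ Finset.HasAntidiagonal.antidiagonal n, shuffleSum p q z.1 z.2 *
        ((∑ α : Equiv.Perm (Fin z.1), chainWeight x τ z.1 α * (p ^ coinv α * q ^ inv α)) *
          ∑ β : Equiv.Perm (Fin z.2), x ^ mch τ β * (p ^ coinv β * q ^ inv β)) := by
  simp only [hτ.pow_mch_eq_sum x hj hn, Finset.sum_mul]
  rw [Finset.sum_comm]
  refine Finset.sum_congr rfl fun z hz => ?_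
  have hz := Finset.HasAntidiagonal.mem_antidiagonal.1 hz
  rw [← Finset.sum_mul]
  refine sum_eq_shuffleSum_mul p q hz _ _ _ fun σ α β hα hβ => ?_
  rw [chainWeight_eq_of_matchAt x hj hα, mch_eq_mchFrom hz hβ]

end Matches

/-- Theorem (Duane–Remmel): if `τ ∈ S_j` (`j ≥ 3`) is minimal overlapping, then
`Σ_{n≥0} (t^n/[n]_{p,q}!) Σ_{σ∈S_n} x^{τ-mch(σ)} p^{coinv σ} q^{inv σ}
  = 1/(1 - (t + Σ_{n≥1} (t^{n(j-1)+1}/[n(j-1)+1]_{p,q}!) (x-1)^n mp_{τ,n(j-1)+1}(p,q)))`,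
as formal power series in `t` over `ℚ(p,q,x)`.  The series
`t + Σ_{n≥1} t^{n(j-1)+1}/[n(j-1)+1]_{p,q}! (x-1)^n mp_{τ,n(j-1)+1}(p,q)` is encoded as the
power series whose `m`-th coefficient is `(x-1)^n mp_{τ,m}(p,q)/[m]_{p,q}!` when
`m = n(j-1)+1` for some `n ≥ 1` (note that its `m = 1` coefficient, coming from the
extra term `t`, agrees with the `n = 0` term of the sum). -/
theorem stmt0 {j : ℕ} (hj : 3 ≤ j) (τ : Equiv.Perm (Fin j)) (hτ : MinOverlapping τ) :
    (PowerSeries.mk fun n : ℕ =>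
        (pqFact pV qV n)⁻¹ *
          ∑ σ : Equiv.Perm (Fin n), xV ^ mch τ σ * pV ^ coinv σ * qV ^ inv σ) =
      (1 - (PowerSeries.X +
        PowerSeries.mk fun m : ℕ =>
          if 1 ≤ (m - 1) / (j - 1) ∧ m = ((m - 1) / (j - 1)) * (j - 1) + 1 then
            (pqFact pV qV m)⁻¹ * (xV - 1) ^ ((m - 1) / (j - 1)) *
              mpSum τ ((m - 1) / (j - 1)) pV qV
          else 0))⁻¹ := by
  set A : ℕ → K3 := fun n =>
    ∑ σ : Equiv.Perm (Fin n), xV ^ mch τ σ * (pV ^ coinv σ * qV ^ inv σ) with hA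
  set F : ℕ → K3 := fun m =>
    ∑ α : Equiv.Perm (Fin m), chainWeight xV τ m α * (pV ^ coinv α * qV ^ inv α) with hF
  have hF0 : F 0 = 0 := by
    rw [hF]
    dsimp only
    rw [hτ.sum_chainWeight xV hj, if_neg zero_ne_one, if_neg]
    simp
  have hlhs : (PowerSeries.mk fun n : ℕ => (pqFact pV qV n)⁻¹ *
      ∑ σ : Equiv.Perm (Fin n), xV ^ mch τ σ * pV ^ coinv σ * qV ^ inv σ) =
      PowerSeries.mk fun n => (pqFact pV qV n)⁻¹ * A n := by
    simp only [hA, mul_assoc]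
  have hrhs : (PowerSeries.X + PowerSeries.mk fun m : ℕ =>
      if 1 ≤ (m - 1) / (j - 1) ∧ m = ((m - 1) / (j - 1)) * (j - 1) + 1 then
        (pqFact pV qV m)⁻¹ * (xV - 1) ^ ((m - 1) / (j - 1)) *
          mpSum τ ((m - 1) / (j - 1)) pV qV
      else 0) = PowerSeries.mk fun m => (pqFact pV qV m)⁻¹ * F m := by
    ext m
    rw [map_add, PowerSeries.coeff_X, PowerSeries.coeff_mk, PowerSeries.coeff_mk, hF]
    dsimp only
    rw [hτ.sum_chainWeight xV hj]
    by_cases h1 : m = 1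
    · subst h1
      simp [pqFact, pqInt]
    · rw [if_neg h1, if_neg h1, zero_add, mul_ite, mul_zero, mul_assoc]
  rw [hlhs, hrhs, PowerSeries.eq_inv_iff_mul_eq_one (by simp [hF0]), mul_comm, sub_mul, one_mul,
    sub_eq_iff_eq_add]
  ext n
  rw [map_add, PowerSeries.coeff_mul, PowerSeries.coeff_mk, PowerSeries.coeff_one]
  simp only [PowerSeries.coeff_mk]
  rcases Nat.eq_zero_or_pos n with rfl | hn
  · have : A 0 = 1 := by
      rw [hA]
      dsimp only
      rw [sum_weight_of_subsingleton pV qV zero_le_one]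
      simp [mch]
    simp [hF0, this, pqFact]
  · rw [if_neg hn.ne', zero_add]
    rw [show A n = _ from hτ.sum_pow_mch xV hj pV qV hn, Finset.mul_sum]
    refine Finset.sum_congr rfl fun z hz => ?_
    rw [← Finset.HasAntidiagonal.mem_antidiagonal.1 hz, ← shuffleSum_mul_pqFact]
    have h1 := pqFact_ne_zero z.1
    have h2 := pqFact_ne_zero z.2
    have h3 : shuffleSum pV qV z.1 z.2 ≠ 0 := fun h => pqFact_ne_zero (z.1 + z.2) (by
      rw [← shuffleSum_mul_pqFact, h, zero_mul])
    change _ * (_ * (F z.1 * A z.2)) = _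
    field_simp

end CWilf
end
end

section
/- Let j ≥ 3 and let τ = τ_1⋯τ_j ∈ S_j be minimal overlapping with τ_1 = 1 and τ_j = s where 2 ≤ s < j. Then for all n ≥ 0, mp_{τ,(n+1)(j−1)+1}(p,q) = p^{coinv(τ)} q^{inv(τ)} p^{(s−1)n(j−1)} [(n+1)(j−1)+1−s choose j−s]_{p,q} · mp_{τ,n(j−1)+1}(p,q), as polynomials in p and q. -/
open scoped Classical

noncomputable section

namespace CWilf

/-- The field `ℚ(p,q)` of rational functions in two variables. -/
abbrev K2 : Type := FractionRing (MvPolynomial (Fin 2) ℚ)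

/-- The variable `p` in `ℚ(p,q)`. -/
def pW : K2 := algebraMap (MvPolynomial (Fin 2) ℚ) K2 (MvPolynomial.X 0)
/-- The variable `q` in `ℚ(p,q)`. -/
def qW : K2 := algebraMap (MvPolynomial (Fin 2) ℚ) K2 (MvPolynomial.X 1)

/-- The word of `σ`, extended by the identity to all natural numbers. -/
def word {N : ℕ} (σ : Equiv.Perm (Fin N)) (i : ℕ) : ℕ :=
  if h : i < N then (σ ⟨i, h⟩ : ℕ) else i

lemma word_of_lt {N : ℕ} (σ : Equiv.Perm (Fin N)) {i : ℕ} (h : i < N) :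
    word σ i = σ ⟨i, h⟩ := dif_pos h

lemma word_fin {N : ℕ} (σ : Equiv.Perm (Fin N)) (i : Fin N) : word σ i = σ i :=
  word_of_lt σ i.isLt

lemma word_lt {N : ℕ} (σ : Equiv.Perm (Fin N)) {i : ℕ} (h : i < N) : word σ i < N := by
  rw [word_of_lt σ h]; exact (σ _).isLt

lemma word_injective {N : ℕ} (σ : Equiv.Perm (Fin N)) : Function.Injective (word σ) := by
  intro a b hab
  by_cases ha : a < N <;> by_cases hb : b < N
  · rw [word_of_lt σ ha, word_of_lt σ hb] at hab
    simpa using σ.injective (Fin.ext hab)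
  · have := word_lt σ ha
    simp only [word, dif_neg hb] at hab this
    omega
  · have := word_lt σ hb
    simp only [word, dif_neg ha] at hab this
    omega
  · simpa [word, ha, hb] using hab

lemma exists_word_eq {N : ℕ} (σ : Equiv.Perm (Fin N)) {x : ℕ} (hx : x < N) :
    ∃ i < N, word σ i = x :=
  ⟨σ.symm ⟨x, hx⟩, (σ.symm _).isLt, by rw [word_fin]; simp⟩

lemma word_ext {N : ℕ} {σ ρ : Equiv.Perm (Fin N)} (h : ∀ i < N, word σ i = word ρ i) : σ = ρ := by
  ext i
  rw [← word_fin, ← word_fin, h i i.isLt]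

lemma exists_perm_of_word {N : ℕ} (w : ℕ → ℕ) (hlt : ∀ i < N, w i < N)
    (hinj : ∀ a < N, ∀ b < N, w a = w b → a = b) :
    ∃ σ : Equiv.Perm (Fin N), ∀ i < N, word σ i = w i := by
  let f : Fin N → Fin N := fun i => ⟨w i, hlt i i.isLt⟩
  have hf : Function.Injective f := fun a b hab =>
    Fin.ext (hinj a a.isLt b b.isLt (congrArg Fin.val hab))
  exact ⟨Equiv.ofBijective f (Finite.injective_iff_bijective.mp hf),
    fun i hi => by rw [word_of_lt _ hi]; rfl⟩

lemma card_filter_word_lt {N : ℕ} (σ : Equiv.Perm (Fin N)) {x : ℕ} (hx : x ≤ N) :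
    ((Finset.range N).filter fun i => word σ i < x).card = x := by
  rw [← Finset.card_image_of_injective _ (word_injective σ)]
  convert Finset.card_range x using 2
  ext y
  simp only [Finset.mem_image, Finset.mem_filter, Finset.mem_range]
  constructor
  · rintro ⟨i, ⟨-, h⟩, rfl⟩; exact h
  · intro hy
    obtain ⟨i, hi, rfl⟩ := exists_word_eq σ (hy.trans_le hx)
    exact ⟨i, ⟨hi, hy⟩, rfl⟩

/-- An entry is recovered from the set of entries and its rank. -/
lemma eq_nth_card {k : ℕ} {v : ℕ → ℕ} (hv : ∀ a < k, ∀ b < k, v a = v b → a = b) {i : ℕ}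
    (hi : i < k) :
    v i = Nat.nth (· ∈ (Finset.range k).image v)
      ((Finset.range k).filter fun a => v a < v i).card := by
  have hmem : v i ∈ (Finset.range k).image v :=
    Finset.mem_image_of_mem _ (Finset.mem_range.mpr hi)
  conv_lhs => rw [← Nat.nth_count (p := (· ∈ (Finset.range k).image v)) hmem]
  congr 1
  rw [Nat.count_eq_card_filter_range]
  rw [← Finset.card_image_of_injOn (s := (Finset.range k).filter fun a => v a < v i) (f := v)]
  · congr 1
    ext y
    simp only [Finset.mem_image, Finset.mem_filter, Finset.mem_range]
    constructor
    · rintro ⟨hy, a, ha, rfl⟩; exact ⟨a, ⟨ha, hy⟩, rfl⟩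
    · rintro ⟨a, ⟨ha, hy⟩, rfl⟩; exact ⟨hy, a, ha, rfl⟩
  · intro a ha b hb hab
    simp only [Finset.coe_filter, Finset.mem_range, Set.mem_ofPred_eq] at ha hb
    exact hv a ha.1 b hb.1 hab

lemma nth_mem_of_lt_card {B : Finset ℕ} {i : ℕ} (hi : i < B.card) :
    Nat.nth (· ∈ B) i ∈ B :=
  Nat.nth_mem (p := (· ∈ B)) i fun hf => by simpa using hi

lemma nth_lt_nth_iff {B : Finset ℕ} {a b : ℕ} (ha : a < B.card) (hb : b < B.card) :
    Nat.nth (· ∈ B) a < Nat.nth (· ∈ B) b ↔ a < b := by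
  have hf : (Set.ofPred (· ∈ B)).Finite := B.finite_toSet
  have hmono := Nat.nth_strictMonoOn hf
  have hc : hf.toFinset.card = B.card := by congr 1; ext; simp
  exact hmono.lt_iff_lt (by simpa [hc] using ha) (by simpa [hc] using hb)

lemma exists_nth_eq {B : Finset ℕ} {x : ℕ} (hx : x ∈ B) :
    ∃ i < B.card, Nat.nth (· ∈ B) i = x := by
  refine ⟨Nat.count (· ∈ B) x, ?_, Nat.nth_count (p := (· ∈ B)) hx⟩
  rw [Nat.count_eq_card_filter_range]
  refine Finset.card_lt_card ⟨fun y hy => (Finset.mem_filter.mp hy).2, fun h => ?_⟩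
  simpa using h hx

/-- The standardization of the first `k` letters of a word without repetitions. -/
lemma exists_standardization {k : ℕ} {v : ℕ → ℕ} (hv : ∀ a < k, ∀ b < k, v a = v b → a = b) :
    ∃ σ : Equiv.Perm (Fin k), ∀ i < k,
      v i = Nat.nth (· ∈ (Finset.range k).image v) (word σ i) := by
  obtain ⟨σ, hσ⟩ := exists_perm_of_word (N := k)
    (fun i => ((Finset.range k).filter fun a => v a < v i).card)
    (fun i hi => by
      conv_rhs => rw [← Finset.card_range k]
      refine Finset.card_lt_card ⟨Finset.filter_subset _ _, fun h => ?_⟩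
      simpa using h (Finset.mem_range.mpr hi))
    (fun a ha b hb hab => hv a ha b hb (by
      rw [eq_nth_card hv ha, eq_nth_card hv hb]
      exact congrArg _ hab))
  exact ⟨σ, fun i hi => by rw [hσ i hi]; exact eq_nth_card hv hi⟩

lemma card_image_range {k : ℕ} {v : ℕ → ℕ} (hv : ∀ a < k, ∀ b < k, v a = v b → a = b) :
    ((Finset.range k).image v).card = k := by
  rw [Finset.card_image_of_injOn, Finset.card_range]
  intro a ha b hb hab
  simp only [Finset.coe_range, Set.mem_Iio] at ha hb
  exact hv a ha b hb hab

lemma word_lt_iff_of_eq_nth {k : ℕ} {B : Finset ℕ} (hB : B.card = k) {v : ℕ → ℕ}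
    {σ : Equiv.Perm (Fin k)} (h : ∀ i < k, v i = Nat.nth (· ∈ B) (word σ i))
    {a b : ℕ} (ha : a < k) (hb : b < k) : v a < v b ↔ word σ a < word σ b := by
  rw [h a ha, h b hb]
  exact nth_lt_nth_iff (hB ▸ word_lt σ ha) (hB ▸ word_lt σ hb)

lemma eq_of_word_lt_iff {k : ℕ} {σ ρ : Equiv.Perm (Fin k)}
    (h : ∀ a < k, ∀ b < k, (word σ a < word σ b ↔ word ρ a < word ρ b)) : σ = ρ := by
  refine word_ext fun i hi => ?_
  rw [← card_filter_word_lt σ (word_lt σ hi).le, ← card_filter_word_lt ρ (word_lt ρ hi).le]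
  congr 1
  exact Finset.filter_congr fun a ha => h a (Finset.mem_range.mp ha) i hi

lemma matchAt_iff {j N : ℕ} (τ : Equiv.Perm (Fin j)) (σ : Equiv.Perm (Fin N)) (i : ℕ) :
    MatchAt τ σ i ↔ i + j ≤ N ∧ ∀ a < j, ∀ b < j,
      (word τ a < word τ b ↔ word σ (i + a) < word σ (i + b)) := by
  constructor
  · rintro ⟨h, H⟩
    refine ⟨h, fun a ha b hb => ?_⟩
    rw [word_of_lt τ ha, word_of_lt τ hb, word_of_lt σ (by omega : i + a < N),
      word_of_lt σ (by omega : i + b < N)]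
    exact H ⟨a, ha⟩ ⟨b, hb⟩
  · rintro ⟨h, H⟩
    refine ⟨h, fun a b => ?_⟩
    have := H a a.isLt b b.isLt
    rwa [word_fin τ a, word_fin τ b, word_of_lt σ (by omega : i + (a : ℕ) < N),
      word_of_lt σ (by omega : i + (b : ℕ) < N)] at this

/-- Two matches of a minimal overlapping pattern share at most one position. -/
lemma MinOverlapping.add_le {j N : ℕ} {τ : Equiv.Perm (Fin j)} (hj : 0 < j)
    (hτ : MinOverlapping τ) (σ : Equiv.Perm (Fin N)) {i i' : ℕ} (hi : MatchAt τ σ i)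
    (hi' : MatchAt τ σ i') (hlt : i < i') : i + (j - 1) ≤ i' := by
  have hex : ∃ m, i < m ∧ MatchAt τ σ m := ⟨i', hlt, hi'⟩
  set m := Nat.find hex with hm
  obtain ⟨him, hmm⟩ := Nat.find_spec hex
  rw [← hm] at him hmm
  have hle : m ≤ i' := Nat.find_min' hex ⟨hlt, hi'⟩
  refine le_trans ?_ hle
  by_contra hcon
  have hmN := ((matchAt_iff τ σ m).mp hmm).1
  have hv : ∀ a < m - i + j, ∀ b < m - i + j, word σ (i + a) = word σ (i + b) → a = b :=
    fun a _ b _ hab => by have := word_injective σ hab; omega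
  obtain ⟨ρ, hρ⟩ := exists_standardization hv
  have hord : ∀ a < m - i + j, ∀ b < m - i + j,
      (word σ (i + a) < word σ (i + b) ↔ word ρ a < word ρ b) := fun a ha b hb =>
    word_lt_iff_of_eq_nth (v := fun a => word σ (i + a)) (card_image_range hv) hρ ha hb
  have hmatch : ∀ x, MatchAt τ ρ x ↔ x + j ≤ m - i + j ∧ MatchAt τ σ (i + x) := by
    intro x
    rw [matchAt_iff, matchAt_iff]
    constructor
    · rintro ⟨h, H⟩
      refine ⟨h, by omega, fun a ha b hb => (H a ha b hb).trans ?_⟩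
      rw [add_assoc, add_assoc]
      exact (hord _ (by omega) _ (by omega)).symm
    · rintro ⟨h, -, H⟩
      refine ⟨h, fun a ha b hb => (H a ha b hb).trans ?_⟩
      rw [add_assoc, add_assoc]
      exact hord _ (by omega) _ (by omega)
  have h2 : mch τ ρ = 2 := by
    have hset : ((Finset.range (m - i + j)).filter fun x => MatchAt τ ρ x) = {0, m - i} := by
      ext x
      simp only [Finset.mem_filter, Finset.mem_range, hmatch, Finset.mem_insert,
        Finset.mem_singleton]
      constructor
      · rintro ⟨-, hx, hx'⟩
        by_contra hne
        exact Nat.find_min hex (m := i + x) (by omega) ⟨by omega, hx'⟩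
      · rintro (rfl | rfl)
        · exact ⟨by omega, by omega, hi⟩
        · refine ⟨by omega, le_rfl, ?_⟩
          rwa [show i + (m - i) = m by omega]
    rw [mch, hset, Finset.card_pair (by omega)]
  have := hτ.2 ⟨ρ, h2⟩
  omega

/-- The word `v` is a chain of `n` copies of the pattern `t`, of length `d + 1` each, with
consecutive copies sharing one letter. -/
def IsPacking (d : ℕ) (t v : ℕ → ℕ) (n : ℕ) : Prop :=
  ∀ k < n, ∀ a ≤ d, ∀ b ≤ d, (t a < t b ↔ v (k * d + a) < v (k * d + b))

lemma mch_eq_iff_isPacking {d n N : ℕ} (hd : 0 < d) (hN : N = n * d + 1)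
    {τ : Equiv.Perm (Fin (d + 1))} (hτ : MinOverlapping τ) (σ : Equiv.Perm (Fin N)) :
    mch τ σ = n ↔ IsPacking d (word τ) (word σ) n := by
  have hgap : ∀ i i', MatchAt τ σ i → MatchAt τ σ i' → i < i' → i + d ≤ i' :=
    fun i i' h h' hlt => hτ.add_le (Nat.succ_pos d) σ h h' hlt
  have hbound : ∀ i, MatchAt τ σ i → i + d ≤ n * d := fun i h => by
    have := ((matchAt_iff τ σ i).mp h).1
    omega
  have hmaps : ∀ i ∈ (Finset.range N).filter (fun i => MatchAt τ σ i),
      i / d ∈ Finset.range n := by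
    intro i hi
    rw [Finset.mem_range, Nat.div_lt_iff_lt_mul hd]
    have := hbound i (Finset.mem_filter.mp hi).2
    omega
  have hinj : Set.InjOn (· / d) ((Finset.range N).filter (fun i => MatchAt τ σ i) : Set ℕ) := by
    intro a ha b hb hab
    have ha := (Finset.mem_filter.mp ha).2
    have hb := (Finset.mem_filter.mp hb).2
    have hab : a / d = b / d := hab
    by_contra hne
    rcases Nat.lt_or_gt_of_ne hne with h | h
    · have h1 := Nat.div_le_div_right (c := d) (hgap a b ha hb h)
      rw [Nat.add_div_right _ hd] at h1
      omega
    · have h1 := Nat.div_le_div_right (c := d) (hgap b a hb ha h)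
      rw [Nat.add_div_right _ hd] at h1
      omega
  constructor
  · intro hcard
    have hsurj : ∀ k < n, ∃ i, MatchAt τ σ i ∧ i / d = k := by
      intro k hk
      have himg := Finset.eq_of_subset_of_card_le (Finset.image_subset_iff.mpr hmaps)
        (by rw [Finset.card_image_of_injOn hinj, Finset.card_range]; exact hcard.ge)
      have hk' := Finset.mem_range.mpr hk
      rw [← himg] at hk'
      obtain ⟨i, hi, hik⟩ := Finset.mem_image.mp hk'
      exact ⟨i, (Finset.mem_filter.mp hi).2, hik⟩
    have hmain : ∀ e, ∀ k, k + e + 1 = n → MatchAt τ σ (k * d) := by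
      intro e
      induction e with
      | zero =>
        intro k hk
        obtain ⟨i, hi, hik⟩ := hsurj k (by omega)
        have h1 := hbound i hi
        have h2 := Nat.div_mul_le_self i d
        rw [hik] at h2
        rw [← hk, add_zero, Nat.succ_mul] at h1
        rwa [show k * d = i by omega]
      | succ e ih =>
        intro k hk
        obtain ⟨i, hi, hik⟩ := hsurj k (by omega)
        have h0 : i < (k + 1) * d := by
          rw [← Nat.div_lt_iff_lt_mul hd]; omega
        have h1 := hgap i _ hi (ih (k + 1) (by omega)) h0
        have h2 := Nat.div_mul_le_self i d
        rw [hik] at h2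
        rw [Nat.succ_mul] at h1
        rwa [show k * d = i by omega]
    intro k hk a ha b hb
    exact ((matchAt_iff τ σ _).mp (hmain (n - 1 - k) k (by omega))).2 a (by omega) b (by omega)
  · intro hpk
    apply le_antisymm
    · have h := Finset.card_le_card_of_injOn _ hmaps hinj
      rwa [Finset.card_range] at h
    · have h := Finset.card_le_card_of_injOn (s := Finset.range n)
        (t := (Finset.range N).filter (fun i => MatchAt τ σ i)) (· * d) (by
          intro k hk
          have hk : k < n := by simpa using hk
          have hle : (k + 1) * d ≤ n * d := Nat.mul_le_mul_right d hk
          rw [Nat.succ_mul] at hle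
          simp only [Finset.coe_filter, Finset.mem_range, Set.mem_ofPred_eq, matchAt_iff]
          exact ⟨by omega, by omega, fun a ha b hb => hpk k hk a (by omega) b (by omega)⟩)
        (fun a _ b _ hab => Nat.eq_of_mul_eq_mul_right hd hab)
      rwa [Finset.card_range] at h

lemma isPacking_succ_iff {d n : ℕ} {t v : ℕ → ℕ} :
    IsPacking d t v (n + 1) ↔ (∀ a ≤ d, ∀ b ≤ d, (t a < t b ↔ v a < v b)) ∧
      IsPacking d t (fun i => v (d + i)) n := by
  constructor
  · intro h
    refine ⟨fun a ha b hb => by simpa using h 0 (by omega) a ha b hb, fun k hk a ha b hb => ?_⟩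
    have := h (k + 1) (by omega) a ha b hb
    simpa only [Nat.succ_mul, add_comm, add_left_comm, add_assoc] using this
  · rintro ⟨h0, h⟩ k hk a ha b hb
    rcases k with _ | k
    · simpa using h0 a ha b hb
    · have := h k (by omega) a ha b hb
      simpa only [Nat.succ_mul, add_comm, add_left_comm, add_assoc] using this

lemma IsPacking.congr {d n : ℕ} {t v v' : ℕ → ℕ}
    (h : ∀ a < n * d + 1, ∀ b < n * d + 1, (v a < v b ↔ v' a < v' b)) (hv : IsPacking d t v n) :
    IsPacking d t v' n := by
  intro k hk a ha b hb
  have hle : (k + 1) * d ≤ n * d := Nat.mul_le_mul_right d hk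
  rw [Nat.succ_mul] at hle
  exact (hv k hk a ha b hb).trans (h _ (by omega) _ (by omega))

/-- If the pattern starts with its minimum, then so does every packing. -/
lemma IsPacking.zero_lt {d n : ℕ} {t : ℕ → ℕ} (ht : ∀ a, 0 < a → a ≤ d → t 0 < t a)
    {v : ℕ → ℕ} (hv : IsPacking d t v n) {b : ℕ} (hb : 0 < b) (hb' : b < n * d + 1) :
    v 0 < v b := by
  induction n generalizing v b with
  | zero => omega
  | succ n ih =>
    obtain ⟨h0, h1⟩ := isPacking_succ_iff.mp hv
    rw [Nat.succ_mul] at hb'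
    rcases le_or_gt b d with hbd | hbd
    · exact (h0 0 (by omega) b hbd).mp (ht b hb hbd)
    · have hd : 0 < d := Nat.pos_of_ne_zero (by rintro rfl; omega)
      have h2 : v (d + 0) < v (d + (b - d)) := ih h1 (by omega) (by omega)
      rw [show d + (b - d) = b by omega, add_zero] at h2
      exact ((h0 0 (by omega) d le_rfl).mp (ht d hd le_rfl)).trans h2

section Weight

variable {K : Type} [CommSemiring K] (p q : K)

/-- The weight of a pair of letters `u`, `v`, with `u` standing to the left of `v`. -/
def pairWeight (u v : ℕ) : K := if u < v then p else if v < u then q else 1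

/-- The product of the weights of all pairs among the first `N` letters of `w`. -/
def wordWeight (w : ℕ → ℕ) (N : ℕ) : K :=
  ∏ b ∈ Finset.range N, ∏ a ∈ Finset.range b, pairWeight p q (w a) (w b)

lemma wordWeight_congr {w w' : ℕ → ℕ} {N : ℕ}
    (h : ∀ a < N, ∀ b < N, (w a < w b ↔ w' a < w' b)) :
    wordWeight p q w N = wordWeight p q w' N := by
  refine Finset.prod_congr rfl fun b hb => Finset.prod_congr rfl fun a ha => ?_
  have hb := Finset.mem_range.mp hb
  have ha := Finset.mem_range.mp ha
  simp only [pairWeight, h a (by omega) b hb, h b hb a (by omega)]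

lemma pow_inv_mul_pow_coinv {N : ℕ} (σ : Equiv.Perm (Fin N)) :
    q ^ inv σ * p ^ coinv σ = wordWeight p q (word σ) N := by
  have hw : wordWeight p q (word σ) N = ∏ b : Fin N, ∏ a : Fin N,
      (if a < b then pairWeight p q (σ a) (σ b) else 1) := by
    rw [wordWeight, Finset.prod_range]
    refine Finset.prod_congr rfl fun b _ => ?_
    have hr : Finset.range (b : ℕ) = (Finset.range N).filter (· < (b : ℕ)) := by
      ext a
      simp only [Finset.mem_range, Finset.mem_filter]
      have := b.isLt
      omega
    rw [hr, Finset.prod_filter, Finset.prod_range]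
    refine Finset.prod_congr rfl fun a _ => ?_
    simp only [word_fin, Fin.lt_def]
  rw [hw, inv, coinv, ← Finset.prod_const, ← Finset.prod_const, Finset.prod_filter,
    Finset.prod_filter, ← Finset.prod_mul_distrib, ← Finset.univ_product_univ,
    Finset.prod_product_right]
  refine Finset.prod_congr rfl fun b _ => Finset.prod_congr rfl fun a _ => ?_
  by_cases hab : a < b
  · rcases lt_or_gt_of_ne (fun h => hab.ne (σ.injective h) : σ a ≠ σ b) with h | h
    · simp [pairWeight, hab, h, h.not_gt]
    · have h' : ¬ (σ a : ℕ) < σ b := fun hc => h.not_gt hc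
      simp [pairWeight, hab, h, h', h.not_gt]
  · simp [hab]

lemma wordWeight_split (w : ℕ → ℕ) (d m : ℕ) :
    wordWeight p q w (d + (m + 1)) = wordWeight p q w (d + 1) *
      (∏ b ∈ Finset.range m, ∏ a ∈ Finset.range d, pairWeight p q (w a) (w (d + (b + 1)))) *
      wordWeight p q (fun i => w (d + i)) (m + 1) := by
  have h1 : wordWeight p q w (d + (m + 1)) = wordWeight p q w d *
      ((∏ b ∈ Finset.range (m + 1), ∏ a ∈ Finset.range d, pairWeight p q (w a) (w (d + b))) *
      wordWeight p q (fun i => w (d + i)) (m + 1)) := by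
    unfold wordWeight
    rw [Finset.prod_range_add, ← Finset.prod_mul_distrib]
    congr 1
    exact Finset.prod_congr rfl fun b _ => Finset.prod_range_add _ _ _
  have h2 : wordWeight p q w (d + 1) = wordWeight p q w d *
      ∏ a ∈ Finset.range d, pairWeight p q (w a) (w d) := Finset.prod_range_succ _ _
  rw [h1, h2, Finset.prod_range_succ']
  simp only [add_zero]
  ring

/-- The sum over the `k`-subsets of an interval of length `m` of the weights of the pairs
separated by the subset. -/
def subsetSum (s m k : ℕ) : K :=
  ∑ A ∈ Finset.powersetCard k (Finset.Ico s (s + m)),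
    ∏ v ∈ Finset.Ico s (s + m) \ A, ∏ u ∈ A, pairWeight p q u v

lemma subsetSum_zero_right (s m : ℕ) : subsetSum p q s m 0 = 1 := by
  simp [subsetSum]

lemma subsetSum_of_lt (s : ℕ) {m k : ℕ} (h : m < k) : subsetSum p q s m k = 0 := by
  rw [subsetSum, Finset.powersetCard_eq_empty.mpr (by simpa using h), Finset.sum_empty]

lemma subsetSum_succ_succ (s m k : ℕ) :
    subsetSum p q s (m + 1) (k + 1) =
      p ^ (k + 1) * subsetSum p q s m (k + 1) + q ^ (m - k) * subsetSum p q s m k := by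
  have hI : Finset.Ico s (s + (m + 1)) = insert (s + m) (Finset.Ico s (s + m)) := by
    ext; simp only [Finset.mem_Ico, Finset.mem_insert]; omega
  have hnot : s + m ∉ Finset.Ico s (s + m) := by simp
  have hcard : (Finset.Ico s (s + m)).card = m := by simp
  simp only [subsetSum]
  rw [hI, Finset.powersetCard_succ_insert hnot, Finset.sum_union, Finset.sum_image]
  · rw [Finset.mul_sum, Finset.mul_sum]
    congr 1
    · refine Finset.sum_congr rfl fun A hA => ?_
      obtain ⟨hA, hAk⟩ := Finset.mem_powersetCard.mp hA
      rw [Finset.insert_sdiff_of_notMem _ (fun h => hnot (hA h)),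
        Finset.prod_insert (fun h => hnot (Finset.mem_sdiff.mp h).1), ← hAk]
      congr 1
      refine Finset.prod_eq_pow_card fun u hu => if_pos ?_
      have := Finset.mem_Ico.mp (hA hu)
      omega
    · refine Finset.sum_congr rfl fun A hA => ?_
      obtain ⟨hA, hAk⟩ := Finset.mem_powersetCard.mp hA
      have hsd : insert (s + m) (Finset.Ico s (s + m)) \ insert (s + m) A =
          Finset.Ico s (s + m) \ A := by
        ext x
        simp only [Finset.mem_sdiff, Finset.mem_insert, Finset.mem_Ico]
        constructor
        · rintro ⟨h1 | h1, h2⟩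
          · exact absurd (Or.inl h1) h2
          · exact ⟨h1, fun h => h2 (Or.inr h)⟩
        · rintro ⟨h1, h2⟩
          refine ⟨Or.inr h1, fun h => h.elim (fun h => ?_) h2⟩
          omega
      have hcs : m - k = (Finset.Ico s (s + m) \ A).card := by
        rw [Finset.card_sdiff_of_subset hA, hcard, hAk]
      rw [hsd, hcs, ← Finset.prod_const, ← Finset.prod_mul_distrib]
      refine Finset.prod_congr rfl fun v hv => ?_
      rw [Finset.prod_insert (fun h => hnot (hA h))]
      have := Finset.mem_Ico.mp (Finset.mem_sdiff.mp hv).1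
      rw [pairWeight, if_neg (by omega), if_pos (by omega)]
  · intro A hA B hB hAB
    have hA := (Finset.mem_powersetCard.mp hA).1
    have hB := (Finset.mem_powersetCard.mp hB).1
    rw [← Finset.erase_insert (fun h => hnot (hA h)), hAB,
      Finset.erase_insert (fun h => hnot (hB h))]
  · rw [Finset.disjoint_left]
    intro A hA hA'
    obtain ⟨B, -, rfl⟩ := Finset.mem_image.mp hA'
    exact hnot ((Finset.mem_powersetCard.mp hA).1 (Finset.mem_insert_self _ _))

lemma pqInt_add (k l : ℕ) :
    pqInt p q (k + l) = q ^ l * pqInt p q k + p ^ k * pqInt p q l := by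
  rw [pqInt, add_comm k l, Finset.sum_range_add, add_comm, pqInt, pqInt, Finset.mul_sum,
    Finset.mul_sum]
  congr 1
  · refine Finset.sum_congr rfl fun i hi => ?_
    rw [show l + k - 1 - (l + i) = k - 1 - i by omega, pow_add]
    ring
  · refine Finset.sum_congr rfl fun i hi => ?_
    have := Finset.mem_range.mp hi
    rw [show l + k - 1 - i = k + (l - 1 - i) by omega, pow_add]
    ring

lemma subsetSum_mul_pqFact (s k l : ℕ) :
    subsetSum p q s (k + l) k * (pqFact p q k * pqFact p q l) = pqFact p q (k + l) := by
  generalize hm : k + l = m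
  induction m generalizing k l with
  | zero =>
    obtain ⟨rfl, rfl⟩ : k = 0 ∧ l = 0 := by omega
    simp [subsetSum_zero_right, pqFact]
  | succ m ih =>
    rcases k with _ | k
    · obtain rfl : l = m + 1 := by omega
      simp [subsetSum_zero_right, pqFact]
    rw [subsetSum_succ_succ]
    rcases l with _ | l
    · obtain rfl : k = m := by omega
      have h := ih k 0 rfl
      simp only [pqFact, mul_one] at h
      rw [subsetSum_of_lt p q s (Nat.lt_succ_self k)]
      simp only [pqFact, mul_one, mul_zero, zero_add, Nat.sub_self, pow_zero, one_mul]
      rw [← mul_assoc, h]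
    · have h1 := ih k (l + 1) (by omega)
      have h2 := ih (k + 1) l (by omega)
      rw [show m - k = l + 1 by omega]
      calc _ = p ^ (k + 1) * pqInt p q (l + 1) *
            (subsetSum p q s m (k + 1) * (pqFact p q (k + 1) * pqFact p q l)) +
            q ^ (l + 1) * pqInt p q (k + 1) *
            (subsetSum p q s m k * (pqFact p q k * pqFact p q (l + 1))) := by
              simp only [pqFact]; ring
        _ = pqFact p q m * (q ^ (l + 1) * pqInt p q (k + 1) +
            p ^ (k + 1) * pqInt p q (l + 1)) := by rw [h1, h2]; ring
        _ = _ := by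
          rw [← pqInt_add, show k + 1 + (l + 1) = m + 1 by omega]; rfl

end Weight

lemma pqInt_ne_zero (n : ℕ) : pqInt pW qW (n + 1) ≠ 0 := by
  have h : pqInt pW qW (n + 1) = algebraMap (MvPolynomial (Fin 2) ℚ) K2
      (pqInt (MvPolynomial.X 0) (MvPolynomial.X 1) (n + 1)) := by
    simp [pqInt, pW, qW]
  rw [h, Ne, map_eq_zero_iff _ (IsFractionRing.injective (MvPolynomial (Fin 2) ℚ) K2)]
  intro h0
  have h1 := congrArg (MvPolynomial.eval fun _ => (1 : ℚ)) h0
  simp only [pqInt, map_sum, map_mul, map_pow, MvPolynomial.eval_X, one_pow, mul_one,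
    Finset.sum_const, Finset.card_range, nsmul_eq_mul, map_zero] at h1
  exact Nat.cast_ne_zero.mpr (Nat.succ_ne_zero n) h1

lemma pqFact_ne_zero_s1 (n : ℕ) : pqFact pW qW n ≠ 0 := by
  induction n with
  | zero => exact one_ne_zero
  | succ n ih => exact mul_ne_zero ih (pqInt_ne_zero n)

lemma pqBinom_eq_subsetSum (s : ℕ) {m k : ℕ} (h : k ≤ m) :
    pqBinom pW qW m k = subsetSum pW qW s m k := by
  rw [pqBinom, if_pos h, div_eq_iff (mul_ne_zero (pqFact_ne_zero_s1 _) (pqFact_ne_zero_s1 _))]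
  obtain ⟨l, rfl⟩ := Nat.exists_eq_add_of_le h
  rw [Nat.add_sub_cancel_left]
  exact (subsetSum_mul_pqFact pW qW s k l).symm

/-- The letters `≥ s` among the first `d` letters of `w`. -/
def largeLetters (s d : ℕ) (w : ℕ → ℕ) : Finset ℕ :=
  ((Finset.range d).image w).filter (s ≤ ·)

lemma tail_injOn {N : ℕ} (d m : ℕ) (σ : Equiv.Perm (Fin N)) :
    ∀ a < m, ∀ b < m, word σ (d + a) = word σ (d + b) → a = b :=
  fun _ _ _ _ h => Nat.add_left_cancel (word_injective σ h)

/-- The standardization of the `m` letters of `σ` that follow the first `d` ones. -/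
def tailPerm {N : ℕ} (d m : ℕ) (σ : Equiv.Perm (Fin N)) : Equiv.Perm (Fin m) :=
  (exists_standardization (tail_injOn d m σ)).choose

lemma word_add_eq_nth {N : ℕ} (d m : ℕ) (σ : Equiv.Perm (Fin N)) {i : ℕ} (hi : i < m) :
    word σ (d + i) = Nat.nth (· ∈ (Finset.range m).image fun i => word σ (d + i))
      (word (tailPerm d m σ) i) :=
  (exists_standardization (tail_injOn d m σ)).choose_spec i hi

lemma word_add_lt_iff {N : ℕ} (d m : ℕ) (σ : Equiv.Perm (Fin N)) {a b : ℕ} (ha : a < m)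
    (hb : b < m) :
    word σ (d + a) < word σ (d + b) ↔ word (tailPerm d m σ) a < word (tailPerm d m σ) b :=
  word_lt_iff_of_eq_nth (v := fun i => word σ (d + i)) (card_image_range (tail_injOn d m σ))
    (fun _ hi => word_add_eq_nth d m σ hi) ha hb

section Structure

variable {d n N s : ℕ} {τ : Equiv.Perm (Fin (d + 1))} {σ : Equiv.Perm (Fin N)}

lemma isPacking_tailPerm (hσ : IsPacking d (word τ) (word σ) (n + 1)) :
    IsPacking d (word τ) (word (tailPerm d (n * d + 1) σ)) n :=
  (isPacking_succ_iff.mp hσ).2.congr fun _ ha _ hb => word_add_lt_iff d _ σ ha hb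

lemma word_zero_lt (h0 : word τ 0 = 0) (a : ℕ) (ha : 0 < a) : word τ 0 < word τ a := by
  have : word τ a ≠ word τ 0 := fun h => ha.ne' (word_injective τ h)
  omega

lemma word_lt_word_of_lt (h0 : word τ 0 = 0) (hN : N = d + (n * d + 1))
    (hσ : IsPacking d (word τ) (word σ) (n + 1)) {b : ℕ} (hb : d < b) (hbN : b < N) :
    word σ d < word σ b := by
  have h : word σ (d + 0) < word σ (d + (b - d)) :=
    (isPacking_succ_iff.mp hσ).2.zero_lt (fun a ha _ => word_zero_lt h0 a ha)
      (by omega) (by omega)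
  rwa [show d + (b - d) = b by omega] at h

lemma word_last (h0 : word τ 0 = 0) (hlast : word τ d = s - 1)
    (hN : N = d + (n * d + 1)) (hσ : IsPacking d (word τ) (word σ) (n + 1)) :
    word σ d = s - 1 := by
  rw [← hlast, ← card_filter_word_lt σ (word_lt σ (by omega : d < N)).le,
    ← card_filter_word_lt τ (word_lt τ (Nat.lt_succ_self d)).le]
  congr 1
  ext i
  simp only [Finset.mem_filter, Finset.mem_range]
  constructor
  · rintro ⟨hi, h⟩
    have hid : i ≤ d := by
      by_contra hc
      exact h.not_gt (word_lt_word_of_lt h0 hN hσ (by omega) hi)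
    exact ⟨by omega, ((isPacking_succ_iff.mp hσ).1 i hid d le_rfl).mpr h⟩
  · rintro ⟨hi, h⟩
    exact ⟨by omega, ((isPacking_succ_iff.mp hσ).1 i (by omega) d le_rfl).mp h⟩

variable (h0 : word τ 0 = 0) (hlast : word τ d = s - 1) (hs : 0 < s)
  (hN : N = d + (n * d + 1)) (hσ : IsPacking d (word τ) (word σ) (n + 1))

include h0 hlast hs hN hσ

lemma mem_image_range_iff (x : ℕ) : x ∈ (Finset.range d).image (word σ) ↔
    x < s - 1 ∨ x ∈ largeLetters s d (word σ) := by
  have hd := word_last h0 hlast hN hσ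
  simp only [largeLetters, Finset.mem_filter, Finset.mem_image, Finset.mem_range]
  constructor
  · rintro ⟨i, hi, rfl⟩
    have : word σ i ≠ word σ d := fun h => hi.ne (word_injective σ h)
    rcases le_or_gt s (word σ i) with h | h
    · exact Or.inr ⟨⟨i, hi, rfl⟩, h⟩
    · exact Or.inl (by omega)
  · rintro (hx | ⟨h, -⟩)
    · have := word_lt σ (by omega : d < N)
      obtain ⟨i, hi, rfl⟩ := exists_word_eq σ (by omega : x < N)
      refine ⟨i, ?_, rfl⟩
      by_contra hc
      rcases (not_lt.mp hc).eq_or_lt with rfl | hc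
      · omega
      · have := word_lt_word_of_lt h0 hN hσ hc hi
        omega
    · exact h

lemma image_range : (Finset.range d).image (word σ) =
    Finset.range (s - 1) ∪ largeLetters s d (word σ) := by
  ext x
  rw [mem_image_range_iff h0 hlast hs hN hσ, Finset.mem_union, Finset.mem_range]

lemma image_range_succ : (Finset.range (d + 1)).image (word σ) =
    Finset.range s ∪ largeLetters s d (word σ) := by
  ext x
  rw [Finset.range_add_one, Finset.image_insert, Finset.mem_insert,
    mem_image_range_iff h0 hlast hs hN hσ, word_last h0 hlast hN hσ, Finset.mem_union,
    Finset.mem_range, ← or_assoc]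
  exact or_congr_left (by omega)

lemma image_after : (Finset.range (n * d)).image (fun i => word σ (d + (i + 1))) =
    Finset.Ico s N \ largeLetters s d (word σ) := by
  have hd := word_last h0 hlast hN hσ
  ext x
  have hmem := mem_image_range_iff h0 hlast hs hN hσ x
  simp only [Finset.mem_image, Finset.mem_range, Finset.mem_sdiff, Finset.mem_Ico] at hmem ⊢
  constructor
  · rintro ⟨i, hi, rfl⟩
    have h1 := word_lt_word_of_lt h0 hN hσ (b := d + (i + 1)) (by omega) (by omega)
    refine ⟨⟨by omega, word_lt σ (by omega)⟩, fun h => ?_⟩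
    obtain ⟨k, hk, hk'⟩ := hmem.mpr (Or.inr h)
    have := word_injective σ hk'
    omega
  · rintro ⟨⟨hsx, hx⟩, hnot⟩
    obtain ⟨i, hi, rfl⟩ := exists_word_eq σ hx
    have h1 : ¬ i < d := fun h => (hmem.mp ⟨i, h, rfl⟩).elim (by omega) hnot
    have h2 : i ≠ d := by rintro rfl; omega
    exact ⟨i - d - 1, by omega, by rw [show d + (i - d - 1 + 1) = i by omega]⟩

lemma image_tail : (Finset.range (n * d + 1)).image (fun i => word σ (d + i)) =
    Finset.Ico (s - 1) N \ largeLetters s d (word σ) := by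
  have hd := word_last h0 hlast hN hσ
  have hlt := word_lt σ (by omega : d < N)
  have h := image_after h0 hlast hs hN hσ
  have hr : Finset.range (n * d + 1) = insert 0 ((Finset.range (n * d)).image (· + 1)) := by
    ext x
    cases x <;> simp
  rw [hr, Finset.image_insert, Finset.image_image]
  rw [show ((fun i => word σ (d + i)) ∘ fun x => x + 1) = fun i => word σ (d + (i + 1)) from rfl,
    h]
  ext x
  have hA : s - 1 ∉ largeLetters s d (word σ) := fun h => by
    have := (Finset.mem_filter.mp h).2
    omega
  simp only [add_zero, hd, Finset.mem_insert, Finset.mem_sdiff, Finset.mem_Ico]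
  constructor
  · rintro (rfl | ⟨h1, h2⟩)
    · exact ⟨by omega, hA⟩
    · exact ⟨by omega, h2⟩
  · rintro ⟨h1, h2⟩
    rcases eq_or_ne x (s - 1) with h | h
    · exact Or.inl h
    · exact Or.inr ⟨by omega, h2⟩

lemma largeLetters_mem_powersetCard (hsd : s ≤ d) : largeLetters s d (word σ) ∈
    Finset.powersetCard (d + 1 - s) (Finset.Ico s N) := by
  rw [Finset.mem_powersetCard]
  constructor
  · intro x hx
    obtain ⟨hx, hsx⟩ := Finset.mem_filter.mp hx
    obtain ⟨i, hi, rfl⟩ := Finset.mem_image.mp hx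
    have := Finset.mem_range.mp hi
    exact Finset.mem_Ico.mpr ⟨hsx, word_lt σ (by omega)⟩
  · have h := congrArg Finset.card (image_range h0 hlast hs hN hσ)
    rw [Finset.card_image_of_injective _ (word_injective σ), Finset.card_range,
      Finset.card_union_of_disjoint, Finset.card_range] at h
    · omega
    · rw [Finset.disjoint_left]
      intro x hx hx'
      have := (Finset.mem_filter.mp hx').2
      have := Finset.mem_range.mp hx
      omega

lemma word_eq_nth_of_le {i : ℕ} (hi : i ≤ d) :
    word σ i = Nat.nth (· ∈ Finset.range s ∪ largeLetters s d (word σ)) (word τ i) := by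
  rw [← image_range_succ h0 hlast hs hN hσ,
    eq_nth_card (fun a _ b _ h => word_injective σ h) (Nat.lt_succ_of_le hi)]
  congr 1
  rw [← card_filter_word_lt τ (word_lt τ (Nat.lt_succ_of_le hi)).le]
  congr 1
  refine Finset.filter_congr fun a ha => ?_
  have := Finset.mem_range.mp ha
  exact ((isPacking_succ_iff.mp hσ).1 a (by omega) i hi).symm

lemma wordWeight_packing {K : Type} [CommSemiring K] (p q : K) :
    wordWeight p q (word σ) N = wordWeight p q (word τ) (d + 1) * p ^ ((s - 1) * (n * d)) *
      (∏ v ∈ Finset.Ico s N \ largeLetters s d (word σ),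
        ∏ u ∈ largeLetters s d (word σ), pairWeight p q u v) *
      wordWeight p q (word (tailPerm d (n * d + 1) σ)) (n * d + 1) := by
  have hcard := congrArg Finset.card (image_after h0 hlast hs hN hσ)
  rw [Finset.card_image_of_injective _
    (fun a b h => by have := word_injective σ h; omega), Finset.card_range] at hcard
  have hcross : ∏ b ∈ Finset.range (n * d), ∏ a ∈ Finset.range d,
      pairWeight p q (word σ a) (word σ (d + (b + 1))) =
      p ^ ((s - 1) * (n * d)) * ∏ v ∈ Finset.Ico s N \ largeLetters s d (word σ),
        ∏ u ∈ largeLetters s d (word σ), pairWeight p q u v := by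
    have hp : p ^ ((s - 1) * (n * d)) =
        ∏ _v ∈ Finset.Ico s N \ largeLetters s d (word σ), p ^ (s - 1) := by
      rw [Finset.prod_const, ← hcard, pow_mul]
    rw [hp, ← Finset.prod_mul_distrib,
      ← image_after h0 hlast hs hN hσ,
      Finset.prod_image (fun a _ b _ h => by have := word_injective σ h; omega)]
    refine Finset.prod_congr rfl fun b hb => ?_
    have hb := Finset.mem_range.mp hb
    rw [← Finset.prod_image (s := Finset.range d) (g := word σ)
      (f := fun u => pairWeight p q u (word σ (d + (b + 1))))
      (fun a _ b _ h => word_injective σ h), image_range h0 hlast hs hN hσ, Finset.prod_union]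
    · congr 1
      have hlt := word_lt_word_of_lt h0 hN hσ (b := d + (b + 1)) (by omega) (by omega)
      rw [word_last h0 hlast hN hσ] at hlt
      conv_rhs => rw [← Finset.card_range (s - 1)]
      refine Finset.prod_eq_pow_card fun u hu => if_pos ?_
      exact (Finset.mem_range.mp hu).trans hlt
    · rw [Finset.disjoint_left]
      intro x hx hx'
      have := (Finset.mem_filter.mp hx').2
      have := Finset.mem_range.mp hx
      omega
  have h1 : wordWeight p q (word σ) (d + 1) = wordWeight p q (word τ) (d + 1) :=
    wordWeight_congr p q fun a ha b hb =>
      ((isPacking_succ_iff.mp hσ).1 a (by omega) b (by omega)).symm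
  have h2 : wordWeight p q (fun i => word σ (d + i)) (n * d + 1) =
      wordWeight p q (word (tailPerm d (n * d + 1) σ)) (n * d + 1) :=
    wordWeight_congr p q fun a ha b hb => word_add_lt_iff d _ σ ha hb
  have hsplit := wordWeight_split p q (word σ) d (n * d)
  rw [← hN] at hsplit
  rw [hsplit, hcross, h1, h2]
  ring

end Structure

/-- Every choice of large letters and of a packing of length `n` comes from a packing of
length `n + 1`. -/
lemma exists_packing {d n N s : ℕ} {τ : Equiv.Perm (Fin (d + 1))} (h0 : word τ 0 = 0)
    (hlast : word τ d = s - 1) (hs : 0 < s) (hsd : s ≤ d) (hN : N = d + (n * d + 1))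
    {A : Finset ℕ} (hA : A ∈ Finset.powersetCard (d + 1 - s) (Finset.Ico s N))
    {ρ : Equiv.Perm (Fin (n * d + 1))} (hρ : IsPacking d (word τ) (word ρ) n) :
    ∃ σ : Equiv.Perm (Fin N), IsPacking d (word τ) (word σ) (n + 1) ∧
      largeLetters s d (word σ) = A ∧ tailPerm d (n * d + 1) σ = ρ := by
  obtain ⟨hAs, hAc⟩ := Finset.mem_powersetCard.mp hA
  have hA' : ∀ x ∈ A, s ≤ x ∧ x < N := fun x hx => Finset.mem_Ico.mp (hAs hx)
  have hsN : s ≤ N := by omega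
  set B := Finset.range s ∪ A with hB
  set C := Finset.Ico (s - 1) N \ A with hC
  have hBc : B.card = d + 1 := by
    rw [hB, Finset.card_union_of_disjoint, Finset.card_range, hAc]
    · omega
    · rw [Finset.disjoint_left]
      intro x hx hx'
      have := (hA' x hx').1
      have := Finset.mem_range.mp hx
      omega
  have hCc : C.card = n * d + 1 := by
    rw [hC, Finset.card_sdiff_of_subset, Nat.card_Ico, hAc]
    · omega
    · intro x hx
      have := hA' x hx
      exact Finset.mem_Ico.mpr (by omega)
  have hBN : ∀ x ∈ B, x < N := by
    intro x hx
    rcases Finset.mem_union.mp hx with hx | hx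
    · have := Finset.mem_range.mp hx
      omega
    · exact (hA' x hx).2
  have hCmem : ∀ x ∈ C, s - 1 ≤ x ∧ x < N ∧ x ∉ A := fun x hx =>
    ⟨(Finset.mem_Ico.mp (Finset.mem_sdiff.mp hx).1).1,
      (Finset.mem_Ico.mp (Finset.mem_sdiff.mp hx).1).2, (Finset.mem_sdiff.mp hx).2⟩
  have hsB : Nat.nth (· ∈ B) (s - 1) = s - 1 := by
    have hmem : s - 1 ∈ B :=
      Finset.mem_union_left _ (Finset.mem_range.mpr (by omega))
    have hc : Nat.count (· ∈ B) (s - 1) = s - 1 := by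
      rw [Nat.count_eq_card_filter_range, Finset.filter_true_of_mem, Finset.card_range]
      intro x hx
      have := Finset.mem_range.mp hx
      exact Finset.mem_union_left _ (Finset.mem_range.mpr (by omega))
    have h := Nat.nth_count (p := (· ∈ B)) hmem
    rwa [hc] at h
  have hsC : Nat.nth (· ∈ C) 0 = s - 1 := by
    have hmem : s - 1 ∈ C :=
      Finset.mem_sdiff.mpr ⟨Finset.mem_Ico.mpr ⟨le_rfl, by omega⟩,
        fun h => by have := (hA' _ h).1; omega⟩
    have hc : Nat.count (· ∈ C) (s - 1) = 0 := by
      rw [Nat.count_eq_card_filter_range, Finset.card_eq_zero, Finset.filter_eq_empty_iff]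
      intro x hx hxC
      have := Finset.mem_range.mp hx
      have := (hCmem x hxC).1
      omega
    have h := Nat.nth_count (p := (· ∈ C)) hmem
    rwa [hc] at h
  have hρ0 : word ρ 0 = 0 := by
    obtain ⟨i, hi, hi0⟩ := exists_word_eq ρ (Nat.succ_pos (n * d))
    rcases Nat.eq_zero_or_pos i with rfl | hpos
    · exact hi0
    · have := hρ.zero_lt (fun a ha _ => word_zero_lt h0 a ha) hpos hi
      omega
  have hτB : ∀ i ≤ d, Nat.nth (· ∈ B) (word τ i) ∈ B := fun i hi =>
    nth_mem_of_lt_card ((word_lt τ (Nat.lt_succ_of_le hi)).trans_eq hBc.symm)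
  have hρC : ∀ i < n * d + 1, Nat.nth (· ∈ C) (word ρ i) ∈ C := fun i hi =>
    nth_mem_of_lt_card ((word_lt ρ hi).trans_eq hCc.symm)
  have hτlt : ∀ a ≤ d, ∀ b ≤ d,
      (Nat.nth (· ∈ B) (word τ a) < Nat.nth (· ∈ B) (word τ b) ↔ word τ a < word τ b) :=
    fun a ha b hb => nth_lt_nth_iff ((word_lt τ (Nat.lt_succ_of_le ha)).trans_eq hBc.symm)
      ((word_lt τ (Nat.lt_succ_of_le hb)).trans_eq hBc.symm)
  have hρlt : ∀ a < n * d + 1, ∀ b < n * d + 1,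
      (Nat.nth (· ∈ C) (word ρ a) < Nat.nth (· ∈ C) (word ρ b) ↔ word ρ a < word ρ b) :=
    fun a ha b hb => nth_lt_nth_iff ((word_lt ρ ha).trans_eq hCc.symm)
      ((word_lt ρ hb).trans_eq hCc.symm)
  have hτinj : ∀ a ≤ d, ∀ b ≤ d,
      Nat.nth (· ∈ B) (word τ a) = Nat.nth (· ∈ B) (word τ b) → a = b := by
    intro a ha b hb hab
    have h1 := hτlt a ha b hb
    have h2 := hτlt b hb a ha
    exact word_injective τ (by omega)
  have hρinj : ∀ a < n * d + 1, ∀ b < n * d + 1,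
      Nat.nth (· ∈ C) (word ρ a) = Nat.nth (· ∈ C) (word ρ b) → a = b := by
    intro a ha b hb hab
    have h1 := hρlt a ha b hb
    have h2 := hρlt b hb a ha
    exact word_injective ρ (by omega)
  have hne : ∀ a < d, ∀ b < n * d + 1,
      Nat.nth (· ∈ B) (word τ a) ≠ Nat.nth (· ∈ C) (word ρ b) := by
    intro a ha b hb hab
    have h1 := hCmem _ (hρC b hb)
    rw [← hab] at h1
    rcases Finset.mem_union.mp (hτB a ha.le) with h2 | h2
    · have := Finset.mem_range.mp h2
      have h3 : Nat.nth (· ∈ B) (word τ a) = Nat.nth (· ∈ B) (word τ d) := by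
        rw [hlast, hsB]; omega
      exact ha.ne (hτinj a ha.le d le_rfl h3)
    · exact h1.2.2 h2
  obtain ⟨σ, hσ⟩ := exists_perm_of_word (N := N)
    (fun i => if i < d then Nat.nth (· ∈ B) (word τ i) else Nat.nth (· ∈ C) (word ρ (i - d)))
    (by
      intro i hi
      split_ifs with h
      · exact hBN _ (hτB i h.le)
      · exact (hCmem _ (hρC (i - d) (by omega))).2.1)
    (by
      intro a ha b hb hab
      split_ifs at hab with h1 h2 h2
      · exact hτinj a h1.le b h2.le hab
      · exact absurd hab (hne a h1 _ (by omega))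
      · exact absurd hab.symm (hne b h2 _ (by omega))
      · have := hρinj _ (by omega) _ (by omega) hab
        omega)
  have hσC : ∀ i < n * d + 1, word σ (d + i) = Nat.nth (· ∈ C) (word ρ i) := by
    intro i hi
    rw [hσ _ (by omega), if_neg (by omega), Nat.add_sub_cancel_left]
  have hσB : ∀ i ≤ d, word σ i = Nat.nth (· ∈ B) (word τ i) := by
    intro i hi
    rcases hi.eq_or_lt with rfl | hi
    · have h := hσC 0 (Nat.succ_pos _)
      rw [hρ0, hsC, add_zero] at h
      rw [h, hlast, hsB]
    · rw [hσ _ (by omega), if_pos hi]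
  refine ⟨σ, isPacking_succ_iff.mpr ⟨fun a ha b hb => ?_, hρ.congr fun a ha b hb => ?_⟩, ?_, ?_⟩
  · rw [hσB a ha, hσB b hb, hτlt a ha b hb]
  · rw [hσC a ha, hσC b hb, hρlt a ha b hb]
  · ext x
    simp only [largeLetters, Finset.mem_filter, Finset.mem_image, Finset.mem_range]
    constructor
    · rintro ⟨⟨i, hi, rfl⟩, hx⟩
      rw [hσB i hi.le] at hx ⊢
      rcases Finset.mem_union.mp (hτB i hi.le) with h | h
      · have := Finset.mem_range.mp h
        omega
      · exact h
    · intro hx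
      have hsx := (hA' x hx).1
      obtain ⟨k, hk, hkx⟩ := exists_nth_eq (Finset.mem_union_right (Finset.range s) hx)
      obtain ⟨i, hi, rfl⟩ := exists_word_eq τ (hk.trans_eq hBc)
      have hix : word σ i = x := by rw [hσB i (by omega)]; exact hkx
      refine ⟨⟨i, ?_, hix⟩, hsx⟩
      by_contra hc
      obtain rfl : i = d := by omega
      rw [hσB _ le_rfl, hlast, hsB] at hix
      omega
  · refine eq_of_word_lt_iff fun a ha b hb => ?_
    rw [← word_add_lt_iff d _ σ ha hb, hσC a ha, hσC b hb, hρlt a ha b hb]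

lemma sum_mch_eq {K : Type} [CommSemiring K] (p q : K) {d n N : ℕ} (hd : 0 < d)
    (hN : N = n * d + 1) {τ : Equiv.Perm (Fin (d + 1))} (hτ : MinOverlapping τ) :
    ∑ σ ∈ Finset.univ.filter (fun σ : Equiv.Perm (Fin N) => mch τ σ = n),
      q ^ inv σ * p ^ coinv σ =
    ∑ σ ∈ Finset.univ.filter (fun σ : Equiv.Perm (Fin N) => IsPacking d (word τ) (word σ) n),
      wordWeight p q (word σ) N :=
  Finset.sum_congr (Finset.filter_congr fun σ _ => mch_eq_iff_isPacking hd hN hτ σ)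
    fun σ _ => pow_inv_mul_pow_coinv p q σ

lemma sum_packing_succ {K : Type} [CommSemiring K] (p q : K) {d n N s m : ℕ}
    {τ : Equiv.Perm (Fin (d + 1))} (h0 : word τ 0 = 0)
    (hlast : word τ d = s - 1) (hs : 0 < s) (hsd : s ≤ d) (hN : N = d + (n * d + 1))
    (hm : N = s + m) :
    ∑ σ ∈ Finset.univ.filter
        (fun σ : Equiv.Perm (Fin N) => IsPacking d (word τ) (word σ) (n + 1)),
      wordWeight p q (word σ) N =
    wordWeight p q (word τ) (d + 1) * p ^ ((s - 1) * (n * d)) *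
      subsetSum p q s m (d + 1 - s) *
      ∑ σ ∈ Finset.univ.filter
        (fun σ : Equiv.Perm (Fin (n * d + 1)) => IsPacking d (word τ) (word σ) n),
      wordWeight p q (word σ) (n * d + 1) := by
  rw [subsetSum, ← hm, mul_assoc _ (Finset.sum _ _), Finset.sum_mul_sum, ← Finset.sum_product',
    Finset.mul_sum]
  refine Finset.sum_bij (fun σ _ => (largeLetters s d (word σ), tailPerm d (n * d + 1) σ))
    ?_ ?_ ?_ ?_
  · intro σ hσ
    have hσ := (Finset.mem_filter.mp hσ).2
    exact Finset.mem_product.mpr ⟨largeLetters_mem_powersetCard h0 hlast hs hN hσ hsd,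
      Finset.mem_filter.mpr ⟨Finset.mem_univ _, isPacking_tailPerm hσ⟩⟩
  · intro σ hσ σ' hσ' h
    have hσ := (Finset.mem_filter.mp hσ).2
    have hσ' := (Finset.mem_filter.mp hσ').2
    obtain ⟨hl, ht⟩ := Prod.mk.inj h
    refine word_ext fun i hi => ?_
    rcases le_or_gt i d with hid | hid
    · rw [word_eq_nth_of_le h0 hlast hs hN hσ hid, word_eq_nth_of_le h0 hlast hs hN hσ' hid, hl]
    · obtain ⟨e, rfl⟩ := Nat.exists_eq_add_of_le hid.le
      rw [word_add_eq_nth d (n * d + 1) σ (by omega), word_add_eq_nth d (n * d + 1) σ' (by omega),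
        image_tail h0 hlast hs hN hσ, image_tail h0 hlast hs hN hσ', hl, ht]
  · rintro ⟨A, ρ⟩ h
    obtain ⟨hA, hρ⟩ := Finset.mem_product.mp h
    obtain ⟨σ, hσ, hl, ht⟩ :=
      exists_packing h0 hlast hs hsd hN hA (Finset.mem_filter.mp hρ).2
    exact ⟨σ, Finset.mem_filter.mpr ⟨Finset.mem_univ _, hσ⟩, Prod.ext hl ht⟩
  · intro σ hσ
    rw [wordWeight_packing h0 hlast hs hN (Finset.mem_filter.mp hσ).2 p q]
    ring

/-- Theorem (Duane–Remmel): if `τ ∈ S_j` (`j ≥ 3`) is minimal overlapping with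
`τ_1 = 1` and `τ_j = s` where `2 ≤ s < j`, then for all `n ≥ 0`,
`mp_{τ,(n+1)(j-1)+1}(p,q) = p^{coinv τ} q^{inv τ} p^{(s-1)n(j-1)}
   [(n+1)(j-1)+1-s choose j-s]_{p,q} mp_{τ,n(j-1)+1}(p,q)`. -/
theorem stmt1 {j : ℕ} (hj : 3 ≤ j) (τ : Equiv.Perm (Fin j)) (hτ : MinOverlapping τ)
    (s : ℕ) (hs2 : 2 ≤ s) (hsj : s < j)
    (hfirst : τ ⟨0, by omega⟩ = ⟨0, by omega⟩)
    (hlast : τ ⟨j - 1, by omega⟩ = ⟨s - 1, by omega⟩) :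
    ∀ n : ℕ,
      mpSum τ (n + 1) pW qW =
        pW ^ coinv τ * qW ^ inv τ * pW ^ ((s - 1) * (n * (j - 1))) *
          pqBinom pW qW ((n + 1) * (j - 1) + 1 - s) (j - s) * mpSum τ n pW qW := by
  obtain ⟨d, rfl⟩ : ∃ d, j = d + 1 := ⟨j - 1, by omega⟩
  intro n
  have h0 : word τ 0 = 0 := by
    rw [word_of_lt τ (Nat.succ_pos d)]
    exact congrArg Fin.val hfirst
  have hl : word τ d = s - 1 := by
    rw [word_of_lt τ (Nat.lt_succ_self d)]
    exact congrArg Fin.val hlast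
  have hN : (n + 1) * (d + 1 - 1) + 1 = d + (n * d + 1) := by
    rw [Nat.add_sub_cancel]; ring
  have hN' : (n + 1) * (d + 1 - 1) + 1 = (n + 1) * d + 1 := by rw [Nat.add_sub_cancel]
  have hlhs := sum_mch_eq pW qW (by omega) hN' hτ
  have hrhs := sum_mch_eq pW qW (n := n) (by omega) rfl hτ
  rw [pqBinom_eq_subsetSum s (by omega), mpSum, hlhs,
    sum_packing_succ pW qW h0 hl (by omega) (by omega) hN
      (m := (n + 1) * (d + 1 - 1) + 1 - s) (by omega), ← hrhs, ← pow_inv_mul_pow_coinv,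
    mul_comm (qW ^ inv τ)]
  rfl

end CWilf
end
end
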